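/- For every λ > 0, as n → ∞ one has ln 𝒩̃(n, ⌊(π^{1/3}/2)·c(λ)·n^{2/3}⌋) = n^{2/3}·((π^{1/3}/2)·e(λ) + o(1)). -/

import Mathlib

open Real Filter Asymptotics MeasureTheory

/-- The set of pairs of coprime nonnegative integers (including `(0,1)` and `(1,0)`). -/
abbrev Xc : Type := {x : ℕ × ℕ // Nat.gcd x.1 x.2 = 1}

/-- The total length `∑_{x∈X} ν(x)·√(x₁²+x₂²)` of the chain encoded by `ν`. -/
noncomputable def totalLength (ν : Xc →₀ ℕ) : ℝ :=
  ν.sum fun x m => (m : ℝ) * Real.sqrt ((x.val.1 : ℝ) ^ 2 + (x.val.2 : ℝ) ^ 2)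

/-- `𝒩̃(n,N)`: the number of convex chains with total length in `[n, n+1)` and `N` vertices. -/
noncomputable def numChainsLen (n N : ℕ) : ℕ :=
  Nat.card {ν : Xc →₀ ℕ // totalLength ν ∈ Set.Ico (n : ℝ) ((n : ℝ) + 1) ∧
    ν.support.card = N}

/-- `A(λ) = ζ(3) − Li₃(1−λ)` as an integral over the positive quadrant. -/
noncomputable def Aint (l : ℝ) : ℝ :=
  ∫ t : ℝ × ℝ in Set.Ioi (0:ℝ) ×ˢ Set.Ioi (0:ℝ),
    l * t.1 * Real.exp (-(t.1 + t.2)) /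
      ((1 - Real.exp (-(t.1 + t.2))) * (1 + (l - 1) * Real.exp (-(t.1 + t.2))))

/-- `B(λ) = λ·Li₂(1−λ)/(1−λ)` as an integral over the positive quadrant. -/
noncomputable def Bint (l : ℝ) : ℝ :=
  ∫ t : ℝ × ℝ in Set.Ioi (0:ℝ) ×ˢ Set.Ioi (0:ℝ),
    l * Real.exp (-(t.1 + t.2)) / (1 + (l - 1) * Real.exp (-(t.1 + t.2)))

noncomputable def zeta2 : ℝ := π ^ 2 / 6

noncomputable def cfun (l : ℝ) : ℝ := Bint l / (zeta2 ^ ((1:ℝ)/3) * Aint l ^ ((2:ℝ)/3))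

noncomputable def efun (l : ℝ) : ℝ :=
  3 * (Aint l / zeta2) ^ ((1:ℝ)/3) - cfun l * Real.log l

/-- The part of the open unit disc in the closed first quadrant. -/
def quarterDisc : Set (Fin 2 → ℝ) := {v | 0 ≤ v 0 ∧ 0 ≤ v 1 ∧ v 0 ^ 2 + v 1 ^ 2 < 1}

lemma convex_quarterDisc : Convex ℝ quarterDisc := by
  rintro x ⟨hx0, hx1, hx⟩ y ⟨hy0, hy1, hy⟩ a b ha hb hab
  refine ⟨?_, ?_, ?_⟩
  · simp only [Pi.add_apply, Pi.smul_apply, smul_eq_mul]; positivity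
  · simp only [Pi.add_apply, Pi.smul_apply, smul_eq_mul]; positivity
  · simp only [Pi.add_apply, Pi.smul_apply, smul_eq_mul]
    obtain rfl : b = 1 - a := by linarith
    have key : (a * x 0 + (1 - a) * y 0) ^ 2 + (a * x 1 + (1 - a) * y 1) ^ 2
        = a * (x 0 ^ 2 + x 1 ^ 2) + (1 - a) * (y 0 ^ 2 + y 1 ^ 2)
          - a * (1 - a) * ((x 0 - y 0) ^ 2 + (x 1 - y 1) ^ 2) := by ring
    have h3 : 0 ≤ a * (1 - a) * ((x 0 - y 0) ^ 2 + (x 1 - y 1) ^ 2) := by positivity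
    rcases ha.eq_or_lt with rfl | ha'
    · linarith
    · nlinarith

lemma measurableSet_quarterDisc : MeasurableSet quarterDisc := by
  unfold quarterDisc
  measurability

lemma isBounded_quarterDisc : Bornology.IsBounded quarterDisc := by
  refine (Metric.isBounded_closedBall (x := (0 : Fin 2 → ℝ)) (r := 1)).subset ?_
  rintro x ⟨h0, h1, h⟩
  rw [mem_closedBall_zero_iff, pi_norm_le_iff_of_nonneg zero_le_one]
  intro i
  fin_cases i
  · simp only [Fin.zero_eta, Real.norm_eq_abs, abs_of_nonneg h0]; nlinarith
  · simp only [Fin.mk_one, Real.norm_eq_abs, abs_of_nonneg h1]; nlinarith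

open scoped Pointwise in
lemma smul_quarterDisc_mono ⦃x y : ℝ⦄ (hx : 0 < x) (hxy : x ≤ y) :
    x • quarterDisc ⊆ y • quarterDisc := by
  have hy : 0 < y := hx.trans_le hxy
  rintro _ ⟨v, hv, rfl⟩
  have h0 : (0 : Fin 2 → ℝ) ∈ quarterDisc := by simp [quarterDisc]
  refine ⟨(x / y) • v, ?_, ?_⟩
  · have := convex_quarterDisc hv h0 (a := x / y) (b := 1 - x / y) (by positivity)
      (by rw [sub_nonneg, div_le_one hy]; exact hxy) (by ring)
    simpa using this
  · simp only [smul_smul]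
    congr 1
    field_simp

lemma integral_zero_one_sqrt_one_sub_sq : ∫ x in (0 : ℝ)..1, √(1 - x ^ 2) = π / 4 := by
  have h := integral_sqrt_one_sub_sq
  have hi : ∀ a b : ℝ, IntervalIntegrable (fun x : ℝ => √(1 - x ^ 2)) volume a b :=
    fun a b => Continuous.intervalIntegrable (by fun_prop) a b
  rw [← intervalIntegral.integral_add_adjacent_intervals (hi (-1) 0) (hi 0 1)] at h
  have h2 : ∫ x in (-1 : ℝ)..0, √(1 - x ^ 2) = ∫ x in (0 : ℝ)..1, √(1 - x ^ 2) := by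
    have := intervalIntegral.integral_comp_neg (a := (0 : ℝ)) (b := 1) (fun x : ℝ => √(1 - x ^ 2))
    simp only [neg_zero, neg_sq] at this
    exact this.symm
  linarith

lemma volume_quarterDisc : volume.real quarterDisc = π / 4 := by
  let s : Set (ℝ × ℝ) := {p | 0 ≤ p.1 ∧ 0 ≤ p.2 ∧ p.1 ^ 2 + p.2 ^ 2 < 1}
  have hs : MeasurableSet s := by measurability
  have h1 : volume quarterDisc = volume s := by
    rw [← (volume_preserving_finTwoArrow ℝ).measure_preimage hs.nullMeasurableSet]
    congr 1
  have h2 : volume s = ∫⁻ x in Set.Ioc (0 : ℝ) 1, ENNReal.ofReal √(1 - x ^ 2) := by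
    have hsec : ∀ x : ℝ, volume (Prod.mk x ⁻¹' s) =
        (Set.Icc (0 : ℝ) 1).indicator (fun x => ENNReal.ofReal √(1 - x ^ 2)) x := by
      intro x
      by_cases hx : 0 ≤ x
      · have : Prod.mk x ⁻¹' s = Set.Ico 0 √(1 - x ^ 2) := by
          ext y
          simp only [s, Set.mem_preimage, Set.mem_ofPred_eq, Set.mem_Ico, hx, true_and]
          refine and_congr_right fun hy => ?_
          rw [Real.lt_sqrt hy, lt_sub_iff_add_lt']
        rw [this, Real.volume_Ico, sub_zero]
        by_cases hx1 : x ≤ 1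
        · rw [Set.indicator_of_mem (Set.mem_Icc.2 ⟨hx, hx1⟩)]
        · rw [Set.indicator_of_notMem (by simp [hx1]), Real.sqrt_eq_zero_of_nonpos (by nlinarith)]
          simp
      · have : Prod.mk x ⁻¹' s = ∅ := by
          ext y; simp [s, hx]
        rw [this, Set.indicator_of_notMem (by simp [hx])]
        simp
    rw [Measure.volume_eq_prod, Measure.prod_apply hs]
    simp_rw [hsec]
    rw [lintegral_indicator measurableSet_Icc]
    exact setLIntegral_congr Ioc_ae_eq_Icc.symm
  rw [Measure.real, h1, h2, ← integral_zero_one_sqrt_one_sub_sq,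
    intervalIntegral.integral_of_le zero_le_one, integral_eq_lintegral_of_nonneg_ae]
  · exact ae_of_all _ fun x => Real.sqrt_nonneg _
  · exact (Continuous.aestronglyMeasurable (by fun_prop))

/-- The number of pairs of natural numbers of Euclidean norm less than `R`. -/
noncomputable def latticeCount (R : ℝ) : ℕ :=
  Nat.card {p : ℕ × ℕ // (p.1 : ℝ) ^ 2 + (p.2 : ℝ) ^ 2 < R ^ 2}

open scoped Pointwise in
lemma tendsto_latticeCount_div_sq :
    Tendsto (fun R : ℝ => (latticeCount R : ℝ) / R ^ 2) atTop (nhds (π / 4)) := by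
  have h := tendsto_card_div_pow_atTop_volume' quarterDisc isBounded_quarterDisc
    measurableSet_quarterDisc (convex_quarterDisc.addHaar_frontier volume) smul_quarterDisc_mono
  rw [volume_quarterDisc] at h
  refine h.congr' ?_
  filter_upwards [eventually_gt_atTop 0] with R hR
  have hmem : ∀ p : ℕ × ℕ, (R⁻¹ • (![(p.1 : ℝ), (p.2 : ℝ)] : Fin 2 → ℝ)) ∈ quarterDisc ↔
      (p.1 : ℝ) ^ 2 + (p.2 : ℝ) ^ 2 < R ^ 2 := by
    intro p
    simp only [quarterDisc, Set.mem_ofPred_eq, Pi.smul_apply, Matrix.cons_val_zero,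
      Matrix.cons_val_one, smul_eq_mul]
    have h0 : 0 ≤ R⁻¹ * (p.1 : ℝ) := by positivity
    have h1 : 0 ≤ R⁻¹ * (p.2 : ℝ) := by positivity
    simp only [h0, h1, true_and]
    rw [show (R⁻¹ * (p.1 : ℝ)) ^ 2 + (R⁻¹ * (p.2 : ℝ)) ^ 2
      = ((p.1 : ℝ) ^ 2 + (p.2 : ℝ) ^ 2) / R ^ 2 by field_simp]
    rw [div_lt_one (by positivity)]
  simp only [Fintype.card_fin]
  congr 2
  symm
  unfold latticeCount
  refine Nat.card_congr (Equiv.ofBijective (fun p => ⟨R⁻¹ • ![(p.1.1 : ℝ), (p.1.2 : ℝ)],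
    (hmem _).2 p.2, ?_⟩) ⟨?_, ?_⟩)
  · refine Set.smul_mem_smul_set ?_
    rw [SetLike.mem_coe, Module.Basis.mem_span_iff_repr_mem]
    intro i
    fin_cases i
    · exact ⟨p.1.1, by simp⟩
    · exact ⟨p.1.2, by simp⟩
  · rintro ⟨p, hp⟩ ⟨q, hq⟩ hpq
    have h1 : R⁻¹ • (![(p.1 : ℝ), (p.2 : ℝ)] : Fin 2 → ℝ) = R⁻¹ • ![(q.1 : ℝ), (q.2 : ℝ)] :=
      congrArg Subtype.val hpq
    have := smul_right_injective (Fin 2 → ℝ) (inv_ne_zero hR.ne') h1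
    have e0 := congrFun this 0
    have e1 := congrFun this 1
    simp at e0 e1
    exact Subtype.ext (Prod.ext e0 e1)
  · rintro ⟨v, hv, w, hw, rfl⟩
    rw [SetLike.mem_coe, Module.Basis.mem_span_iff_repr_mem] at hw
    obtain ⟨a, ha⟩ := hw 0
    obtain ⟨b, hb⟩ := hw 1
    simp at ha hb
    have ha0 : 0 ≤ a := by
      have := hv.1
      simp only [Pi.smul_apply, smul_eq_mul, ← ha] at this
      have h2 : (0 : ℝ) ≤ a := by
        by_contra hc
        push Not at hc
        exact absurd this (not_le.2 (mul_neg_of_pos_of_neg (inv_pos.2 hR) hc))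
      exact_mod_cast h2
    have hb0 : 0 ≤ b := by
      have := hv.2.1
      simp only [Pi.smul_apply, smul_eq_mul, ← hb] at this
      have h2 : (0 : ℝ) ≤ b := by
        by_contra hc
        push Not at hc
        exact absurd this (not_le.2 (mul_neg_of_pos_of_neg (inv_pos.2 hR) hc))
      exact_mod_cast h2
    lift a to ℕ using ha0
    lift b to ℕ using hb0
    have hw' : w = ![(((a, b) : ℕ × ℕ).1 : ℝ), (((a, b) : ℕ × ℕ).2 : ℝ)] := by
      ext i; fin_cases i
      · simp [← ha]
      · simp [← hb]
    refine ⟨⟨(a, b), ?_⟩, ?_⟩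
    · rw [← hmem, ← hw']; exact hv
    · simp only [hw']

lemma hasSum_moebius_div_sq :
    HasSum (fun d : ℕ => (ArithmeticFunction.moebius d : ℝ) / (d : ℝ) ^ 2) (zeta2)⁻¹ := by
  have h2 : (1 : ℝ) < (2 : ℂ).re := by norm_num
  have hs := ArithmeticFunction.LSeriesSummable_moebius_iff.2 h2
  have hL := ArithmeticFunction.LSeries_zeta_mul_Lseries_moebius h2
  rw [ArithmeticFunction.LSeries_zeta_eq_riemannZeta h2, riemannZeta_two] at hL
  have hsum := hs.hasSum
  have hval : LSeries (fun n => ((ArithmeticFunction.moebius n : ℤ) : ℂ)) 2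
      = (((zeta2)⁻¹ : ℝ) : ℂ) := by
    have : ((zeta2 : ℝ) : ℂ) = (π : ℂ) ^ 2 / 6 := by simp [zeta2]
    rw [← this] at hL
    rw [Complex.ofReal_inv]
    exact eq_inv_of_mul_eq_one_right hL
  rw [← Complex.hasSum_ofReal]
  rw [← hval]
  convert hsum using 1
  · funext n
    rcases eq_or_ne n 0 with rfl | hn
    · simp
    · rw [LSeries.term_of_ne_zero hn]
      push_cast
      norm_num
  · rfl

/-- The Euclidean norm of a primitive vector. -/
noncomputable def xnorm (x : Xc) : ℝ := √((x.val.1 : ℝ) ^ 2 + (x.val.2 : ℝ) ^ 2)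

/-- The number of primitive vectors of norm less than `R`. -/
noncomputable def primCount (R : ℝ) : ℕ := Nat.card {x : Xc // xnorm x < R}

lemma finite_lattice (R : ℝ) :
    {p : ℕ × ℕ | (p.1 : ℝ) ^ 2 + (p.2 : ℝ) ^ 2 < R ^ 2}.Finite := by
  refine ((Set.finite_Iio ⌈|R|⌉₊).prod (Set.finite_Iio ⌈|R|⌉₊)).subset ?_
  rintro ⟨a, b⟩ h
  simp only [Set.mem_ofPred_eq] at h
  simp only [Set.mem_prod, Set.mem_Iio]
  rw [← sq_abs R] at h
  constructor <;> refine Nat.lt_ceil.2 ?_ <;> by_contra hc <;> push Not at hc <;>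
    nlinarith [abs_nonneg R]

/-- Nonzero lattice points of norm less than `R`. -/
noncomputable def latticePts (R : ℝ) : Finset (ℕ × ℕ) := (finite_lattice R).toFinset.erase (0, 0)

lemma mem_latticePts {R : ℝ} {p : ℕ × ℕ} :
    p ∈ latticePts R ↔ p ≠ (0, 0) ∧ (p.1 : ℝ) ^ 2 + (p.2 : ℝ) ^ 2 < R ^ 2 := by
  simp [latticePts]

lemma card_latticePts {R : ℝ} (hR : 0 < R) : ((latticePts R).card : ℝ) = latticeCount R - 1 := by
  have h : latticeCount R = (finite_lattice R).toFinset.card := by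
    unfold latticeCount
    rw [← Nat.card_eq_card_finite_toFinset (finite_lattice R)]
    rfl
  have h0 : (0, 0) ∈ (finite_lattice R).toFinset := by simp [sq_pos_of_pos hR]
  have := Finset.card_erase_add_one h0
  rw [h, ← this]
  simp [latticePts]

lemma card_latticePts_le {R : ℝ} (hR : 0 < R) : ((latticePts R).card : ℝ) ≤ 4 * R ^ 2 := by
  by_cases h1 : R ≤ 1
  · have : latticePts R = ∅ := by
      rw [Finset.eq_empty_iff_forall_notMem]
      rintro ⟨a, b⟩ h
      rw [mem_latticePts] at h
      have hab : (1 : ℝ) ≤ (a : ℝ) ^ 2 + (b : ℝ) ^ 2 := by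
        have : 1 ≤ a ^ 2 + b ^ 2 := by
          by_contra hc
          have hc' : a ^ 2 + b ^ 2 = 0 := by omega
          have ha : a = 0 := by nlinarith [sq_nonneg b]
          have hb : b = 0 := by nlinarith [sq_nonneg a]
          exact h.1 (by rw [ha, hb])
        exact_mod_cast this
      have := h.2
      simp only at this
      nlinarith
    rw [this]; simp; positivity
  · push Not at h1
    have hsub : latticePts R ⊆ Finset.range ⌈R⌉₊ ×ˢ Finset.range ⌈R⌉₊ := by
      rintro ⟨a, b⟩ h
      rw [mem_latticePts] at h
      have h := h.2
      simp only at h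
      simp only [Finset.mem_product, Finset.mem_range]
      constructor <;> refine Nat.lt_ceil.2 ?_ <;> by_contra hc <;> push Not at hc <;> nlinarith
    have h2 := Finset.card_le_card hsub
    rw [Finset.card_product, Finset.card_range] at h2
    have h3 : ((latticePts R).card : ℝ) ≤ (⌈R⌉₊ : ℝ) * ⌈R⌉₊ := by exact_mod_cast h2
    have h4 := (Nat.ceil_lt_add_one hR.le)
    have h5 : (0 : ℝ) ≤ (⌈R⌉₊ : ℝ) := by positivity
    nlinarith

lemma card_filter_dvd_latticePts {R : ℝ} {d : ℕ} (hd : 0 < d) :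
    ((latticePts R).filter (fun p => d ∣ Nat.gcd p.1 p.2)).card = (latticePts (R / d)).card := by
  symm
  have hd' : (0 : ℝ) < d := by exact_mod_cast hd
  refine Finset.card_bij (fun p _ => (d * p.1, d * p.2)) ?_ ?_ ?_
  · rintro ⟨a, b⟩ h
    rw [mem_latticePts] at h
    rw [Finset.mem_filter, mem_latticePts]
    refine ⟨⟨?_, ?_⟩, ?_⟩
    · intro hc
      apply h.1
      simp only [Prod.mk.injEq, mul_eq_zero, hd.ne', false_or] at hc
      exact Prod.ext hc.1 hc.2
    · have := h.2
      simp only [div_pow] at this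
      rw [lt_div_iff₀ (by positivity)] at this
      push_cast
      nlinarith
    · exact Nat.dvd_gcd (Dvd.intro _ rfl) (Dvd.intro _ rfl)
  · rintro ⟨a, b⟩ _ ⟨a', b'⟩ _ h
    simpa [hd.ne'] using h
  · rintro ⟨a, b⟩ h
    rw [Finset.mem_filter, mem_latticePts] at h
    obtain ⟨a', rfl⟩ := h.2.trans (Nat.gcd_dvd_left _ _)
    obtain ⟨b', hb⟩ := h.2.trans (Nat.gcd_dvd_right _ _)
    simp only at hb
    subst hb
    refine ⟨(a', b'), ?_, rfl⟩
    rw [mem_latticePts]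
    refine ⟨?_, ?_⟩
    · intro hc
      apply h.1.1
      simp only [Prod.mk.injEq] at hc
      simp [hc.1, hc.2]
    · have := h.1.2
      push_cast at this
      simp only [div_pow]
      rw [lt_div_iff₀ (by positivity)]
      nlinarith

lemma latticePts_mono_empty {R : ℝ} (hR : 0 < R) (hR1 : R ≤ 1) : latticePts R = ∅ := by
  rw [Finset.eq_empty_iff_forall_notMem]
  rintro ⟨a, b⟩ h
  rw [mem_latticePts] at h
  have h2 := h.2
  have h3 : (a : ℝ) ^ 2 + (b : ℝ) ^ 2 < 1 := by simp only at h2; nlinarith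
  have h4 : a ^ 2 + b ^ 2 < 1 := by exact_mod_cast h3
  have ha : a = 0 := by nlinarith [sq_nonneg b]
  have hb : b = 0 := by nlinarith [sq_nonneg a]
  exact h.1 (by rw [ha, hb])

lemma primCount_eq_card {R : ℝ} (hR : 0 < R) :
    primCount R = ((latticePts R).filter (fun p => Nat.gcd p.1 p.2 = 1)).card := by
  rw [← Nat.card_eq_finsetCard]
  unfold primCount
  refine Nat.card_congr ⟨fun x => ⟨x.1.1, ?_⟩, fun p => ⟨⟨p.1, (Finset.mem_filter.1 p.2).2⟩, ?_⟩,
    fun _ => rfl, fun _ => rfl⟩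
  · rw [Finset.mem_filter, mem_latticePts]
    refine ⟨⟨?_, ?_⟩, x.1.2⟩
    · intro h
      have := x.1.2
      rw [h] at this
      simp at this
    · have := x.2
      rw [xnorm, Real.sqrt_lt' hR] at this
      exact this
  · rw [xnorm, Real.sqrt_lt' hR]
    exact (mem_latticePts.1 (Finset.mem_filter.1 p.2).1).2

lemma primCount_eq_tsum {R : ℝ} (hR : 0 < R) :
    (primCount R : ℝ) =
      ∑' d : ℕ, (ArithmeticFunction.moebius d : ℝ) * ((latticePts (R / d)).card : ℝ) := by
  rw [primCount_eq_card hR, tsum_eq_sum (s := Finset.range (⌈R⌉₊ + 1)), Finset.card_filter]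
  · have h1 : ∀ p ∈ latticePts R, (if Nat.gcd p.1 p.2 = 1 then (1 : ℤ) else 0) =
        ∑ d ∈ Finset.range (⌈R⌉₊ + 1), if d ∣ Nat.gcd p.1 p.2 then
          ArithmeticFunction.moebius d else 0 := by
      intro p hp
      rw [mem_latticePts] at hp
      have hg : Nat.gcd p.1 p.2 ≠ 0 := by
        intro hc
        rw [Nat.gcd_eq_zero_iff] at hc
        exact hp.1 (Prod.ext hc.1 hc.2)
      have hle : Nat.gcd p.1 p.2 ≤ ⌈R⌉₊ := by
        have h2 := hp.2
        have ha : (p.1 : ℝ) < R := by nlinarith [sq_nonneg (p.2 : ℝ)]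
        have hb : (p.2 : ℝ) < R := by nlinarith [sq_nonneg (p.1 : ℝ)]
        rcases Nat.eq_zero_or_pos p.1 with h0 | h0
        · rw [h0, Nat.gcd_zero_left]
          exact_mod_cast (hb.le.trans (Nat.le_ceil R))
        · refine (Nat.gcd_le_left _ h0).trans ?_
          exact_mod_cast (ha.le.trans (Nat.le_ceil R))
      rw [← Finset.sum_filter]
      have hdiv : (Finset.range (⌈R⌉₊ + 1)).filter (fun d => d ∣ Nat.gcd p.1 p.2)
          = (Nat.gcd p.1 p.2).divisors := by
        ext d
        simp only [Finset.mem_filter, Finset.mem_range, Nat.mem_divisors]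
        constructor
        · exact fun h => ⟨h.2, hg⟩
        · exact fun h => ⟨Nat.lt_succ_of_le ((Nat.le_of_dvd (Nat.pos_of_ne_zero hg) h.1).trans hle),
            h.1⟩
      rw [hdiv, ← ArithmeticFunction.coe_mul_zeta_apply, ArithmeticFunction.moebius_mul_coe_zeta,
        ArithmeticFunction.one_apply]
    have h2 : ((∑ p ∈ latticePts R, if Nat.gcd p.1 p.2 = 1 then 1 else 0 : ℕ) : ℤ) =
        ∑ d ∈ Finset.range (⌈R⌉₊ + 1), ArithmeticFunction.moebius d *
          ((latticePts (R / d)).card : ℤ) := by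
      push_cast
      rw [Finset.sum_congr rfl h1, Finset.sum_comm]
      refine Finset.sum_congr rfl fun d _ => ?_
      rcases Nat.eq_zero_or_pos d with rfl | hd
      · simp
      · rw [← card_filter_dvd_latticePts hd, ← Finset.sum_filter, Finset.sum_const, nsmul_eq_mul,
          mul_comm]
    exact_mod_cast congrArg (Int.cast : ℤ → ℝ) h2
  · intro d hd
    simp only [Finset.mem_range, not_lt] at hd
    have hd' : R ≤ d := (Nat.le_ceil R).trans (by exact_mod_cast (by omega : ⌈R⌉₊ ≤ d))
    have hd0 : (0 : ℝ) < d := hR.trans_le hd'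
    rw [latticePts_mono_empty (by positivity) ((div_le_one hd0).2 hd')]
    simp

lemma primCount_le {R : ℝ} (hR : 0 < R) : (primCount R : ℝ) ≤ 4 * R ^ 2 := by
  rw [primCount_eq_card hR]
  exact le_trans (by exact_mod_cast Finset.card_filter_le _ _) (card_latticePts_le hR)

lemma tendsto_card_latticePts_div_sq :
    Tendsto (fun R : ℝ => ((latticePts R).card : ℝ) / R ^ 2) atTop (nhds (π / 4)) := by
  have h1 : Tendsto (fun R : ℝ => (1 : ℝ) / R ^ 2) atTop (nhds 0) :=
    tendsto_const_nhds.div_atTop (tendsto_pow_atTop two_ne_zero)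
  have h := tendsto_latticeCount_div_sq.sub h1
  rw [sub_zero] at h
  refine h.congr' ?_
  filter_upwards [eventually_gt_atTop 0] with R hR
  rw [card_latticePts hR, sub_div]

/-- Density of primitive vectors in the quadrant. -/
lemma tendsto_primCount_div_sq :
    Tendsto (fun R : ℝ => (primCount R : ℝ) / R ^ 2) atTop (nhds (π / (4 * zeta2))) := by
  have hlim : π / (4 * zeta2) =
      ∑' d : ℕ, (ArithmeticFunction.moebius d : ℝ) / (d : ℝ) ^ 2 * (π / 4) := by
    rw [tsum_mul_right, hasSum_moebius_div_sq.tsum_eq]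
    field_simp
  rw [hlim]
  have hT := tendsto_tsum_of_dominated_convergence (𝓕 := (atTop : Filter ℝ))
    (f := fun (R : ℝ) (d : ℕ) =>
      (ArithmeticFunction.moebius d : ℝ) * ((latticePts (R / d)).card : ℝ) / R ^ 2)
    (g := fun d : ℕ => (ArithmeticFunction.moebius d : ℝ) / (d : ℝ) ^ 2 * (π / 4))
    (bound := fun d : ℕ => 4 * (1 / (d : ℝ) ^ 2)) ?_ ?_ ?_
  · refine hT.congr' ?_
    filter_upwards [eventually_gt_atTop 0] with R hR
    rw [primCount_eq_tsum hR, tsum_div_const]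
  · exact (Real.summable_one_div_nat_pow.2 one_lt_two).mul_left 4
  · intro d
    rcases Nat.eq_zero_or_pos d with rfl | hd
    · simp
    · have hd' : (0 : ℝ) < d := by exact_mod_cast hd
      have h := tendsto_card_latticePts_div_sq.comp (tendsto_id.atTop_div_const hd')
      have h2 := h.const_mul ((ArithmeticFunction.moebius d : ℝ) / (d : ℝ) ^ 2)
      refine h2.congr' ?_
      filter_upwards [eventually_gt_atTop 0] with R hR
      simp only [Function.comp, id]
      field_simp
  · filter_upwards [eventually_gt_atTop 0] with R hR d
    rcases Nat.eq_zero_or_pos d with rfl | hd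
    · simp
    · have hd' : (0 : ℝ) < d := by exact_mod_cast hd
      have h1 := card_latticePts_le (R := R / d) (by positivity)
      have h2 : |(ArithmeticFunction.moebius d : ℝ)| ≤ 1 := by
        exact_mod_cast ArithmeticFunction.abs_moebius_le_one
      rw [Real.norm_eq_abs, abs_div, abs_mul, Nat.abs_cast, abs_of_pos (by positivity : 0 < R ^ 2),
        div_le_iff₀ (by positivity)]
      calc |(ArithmeticFunction.moebius d : ℝ)| * ((latticePts (R / d)).card : ℝ)
          ≤ 1 * (4 * (R / d) ^ 2) := by gcongr
        _ = 4 * (1 / (d : ℝ) ^ 2) * R ^ 2 := by field_simp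

/-- Logarithm of the one-site partition function. -/
noncomputable def siteF (l r : ℝ) : ℝ := Real.log (1 + l / (Real.exp r - 1))

/-- Minus the derivative of `siteF` in the second variable. -/
noncomputable def siteG (l s : ℝ) : ℝ :=
  l * Real.exp (-s) / ((1 - Real.exp (-s)) * (1 + (l - 1) * Real.exp (-s)))

/-- Occupation probability of a site. -/
noncomputable def siteP (l s : ℝ) : ℝ := l * Real.exp (-s) / (1 + (l - 1) * Real.exp (-s))

lemma measurable_siteF (l : ℝ) : Measurable (siteF l) := by unfold siteF; fun_prop
lemma measurable_siteG (l : ℝ) : Measurable (siteG l) := by unfold siteG; fun_prop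
lemma measurable_siteP (l : ℝ) : Measurable (siteP l) := by unfold siteP; fun_prop

lemma exp_sub_one_pos {s : ℝ} (hs : 0 < s) : 0 < Real.exp s - 1 := by
  have := Real.one_lt_exp_iff.2 hs; linarith

lemma one_sub_exp_neg_pos {s : ℝ} (hs : 0 < s) : 0 < 1 - Real.exp (-s) := by
  have := Real.exp_lt_one_iff.2 (neg_lt_zero.2 hs); linarith

lemma site_denom_pos {l s : ℝ} (hl : 0 < l) (hs : 0 < s) : 0 < 1 + (l - 1) * Real.exp (-s) := by
  have := one_sub_exp_neg_pos hs
  have := mul_pos hl (Real.exp_pos (-s))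
  linarith

lemma siteG_pos {l s : ℝ} (hl : 0 < l) (hs : 0 < s) : 0 < siteG l s :=
  div_pos (mul_pos hl (Real.exp_pos _)) (mul_pos (one_sub_exp_neg_pos hs) (site_denom_pos hl hs))

lemma siteP_eq {l s : ℝ} (hl : 0 < l) (hs : 0 < s) : siteP l s = l / (Real.exp s - 1 + l) := by
  have h1 := exp_sub_one_pos hs
  have h2 := site_denom_pos hl hs
  have h3 := Real.exp_pos s
  unfold siteP
  rw [Real.exp_neg] at *
  have h4 : Real.exp s - 1 + l ≠ 0 := by positivity
  rw [div_eq_div_iff h2.ne' h4]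
  field_simp
  ring

lemma siteP_pos {l s : ℝ} (hl : 0 < l) (hs : 0 < s) : 0 < siteP l s :=
  div_pos (mul_pos hl (Real.exp_pos _)) (site_denom_pos hl hs)

lemma siteP_le_one {l s : ℝ} (hl : 0 < l) (hs : 0 < s) : siteP l s ≤ 1 := by
  have h1 := exp_sub_one_pos hs
  rw [siteP_eq hl hs, div_le_one (by positivity)]
  linarith

lemma siteF_nonneg {l s : ℝ} (hl : 0 < l) (hs : 0 < s) : 0 ≤ siteF l s := by
  have h1 := exp_sub_one_pos hs
  exact Real.log_nonneg (by have : 0 < l / (Real.exp s - 1) := by positivity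
                            linarith)

lemma siteF_anti {l s t : ℝ} (hl : 0 < l) (hs : 0 < s) (hst : s ≤ t) : siteF l t ≤ siteF l s := by
  have h1 := exp_sub_one_pos hs
  have h2 := exp_sub_one_pos (hs.trans_le hst)
  unfold siteF
  gcongr

lemma siteF_le {l s : ℝ} (hl : 0 < l) (hs : 0 < s) : siteF l s ≤ l / (Real.exp s - 1) := by
  have h1 := exp_sub_one_pos hs
  have h2 : 0 < l / (Real.exp s - 1) := by positivity
  have := Real.log_le_sub_one_of_pos (show 0 < 1 + l / (Real.exp s - 1) by linarith)
  unfold siteF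
  linarith

lemma siteF_le_div {l s : ℝ} (hl : 0 < l) (hs : 0 < s) : siteF l s ≤ l / s := by
  refine (siteF_le hl hs).trans ?_
  have := Real.add_one_le_exp s
  gcongr
  linarith

lemma id_le_exp_mul {s : ℝ} (hs : 0 < s) : s * Real.exp (s / 2) ≤ Real.exp s - 1 := by
  have h := Real.self_le_sinh_iff.2 (show 0 ≤ s / 2 by positivity)
  rw [Real.sinh_eq] at h
  have h1 : Real.exp (s / 2) * Real.exp (s / 2) = Real.exp s := by
    rw [← Real.exp_add]; ring_nf
  have h2 : Real.exp (-(s / 2)) * Real.exp (s / 2) = 1 := by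
    rw [← Real.exp_add]; simp
  have h3 := Real.exp_pos (s / 2)
  nlinarith

lemma mul_div_exp_sub_one_le {l s : ℝ} (hl : 0 < l) (hs : 0 < s) :
    s * (l / (Real.exp s - 1)) ≤ l * Real.exp (-(1 / 2) * s) := by
  have h1 := exp_sub_one_pos hs
  have h2 := id_le_exp_mul hs
  rw [← mul_div_assoc, div_le_iff₀ h1]
  have h3 : Real.exp (-(1 / 2) * s) * Real.exp (s / 2) = 1 := by
    rw [← Real.exp_add]; ring_nf; simp
  have h4 := Real.exp_pos (-(1 / 2) * s)
  calc s * l = l * (Real.exp (-(1 / 2) * s) * (s * Real.exp (s / 2))) := by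
        rw [mul_left_comm (Real.exp _), h3]; ring
    _ ≤ l * (Real.exp (-(1 / 2) * s) * (Real.exp s - 1)) := by gcongr
    _ = _ := by ring

lemma siteP_le {l s : ℝ} (hl : 0 < l) (hs : 0 < s) : siteP l s ≤ l / (Real.exp s - 1) := by
  have h1 := exp_sub_one_pos hs
  rw [siteP_eq hl hs]
  gcongr
  linarith

lemma hasDerivAt_siteF {l s : ℝ} (hl : 0 < l) (hs : 0 < s) :
    HasDerivAt (siteF l) (-siteG l s) s := by
  have h1 := exp_sub_one_pos hs
  have h2 : 0 < 1 + l / (Real.exp s - 1) := by positivity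
  have hd : HasDerivAt (fun r => 1 + l / (Real.exp r - 1))
      ((0 * (Real.exp s - 1) - l * Real.exp s) / (Real.exp s - 1) ^ 2) s :=
    ((hasDerivAt_const s l).div ((Real.hasDerivAt_exp s).sub_const 1) h1.ne').const_add 1
  have h := hd.log h2.ne'
  unfold siteF
  convert h using 1
  have h3 := one_sub_exp_neg_pos hs
  have h4 := site_denom_pos hl hs
  have h5 := Real.exp_pos s
  unfold siteG
  have h6 : Real.exp s - 1 + l ≠ 0 := by positivity
  have h7 : 1 + l / (Real.exp s - 1) = (Real.exp s - 1 + l) / (Real.exp s - 1) := by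
    field_simp
  rw [h7]
  have h8 : Real.exp (-s) = 1 / Real.exp s := by rw [Real.exp_neg, one_div]
  have h9 : 1 - Real.exp (-s) = (Real.exp s - 1) / Real.exp s := by rw [h8]; field_simp
  have h10 : 1 + (l - 1) * Real.exp (-s) = (Real.exp s - 1 + l) / Real.exp s := by
    rw [h8]; field_simp; ring
  rw [h9, h10, h8]
  field_simp
  ring

lemma tendsto_siteF_atTop {l : ℝ} : Tendsto (siteF l) atTop (nhds 0) := by
  have h1 : Tendsto (fun r : ℝ => 1 + l / (Real.exp r - 1)) atTop (nhds (1 + 0)) := by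
    refine tendsto_const_nhds.add (tendsto_const_nhds.div_atTop ?_)
    exact tendsto_atTop_add_const_right _ _ Real.tendsto_exp_atTop
  have h2 := (Real.continuousAt_log (x := 1 + 0) (by norm_num)).tendsto.comp h1
  rw [add_zero, Real.log_one] at h2
  exact h2

lemma lintegral_Ioi_siteG {l r : ℝ} (hl : 0 < l) (hr : 0 < r) :
    ∫⁻ s in Set.Ioi r, ENNReal.ofReal (siteG l s) = ENNReal.ofReal (siteF l r) := by
  have hd : ∀ x ∈ Set.Ici r, HasDerivAt (fun s => -siteF l s) (siteG l x) x := by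
    intro x hx
    have := (hasDerivAt_siteF hl (hr.trans_le hx)).fun_neg
    rwa [neg_neg] at this
  have hpos : ∀ x ∈ Set.Ioi r, 0 ≤ siteG l x := fun x hx => (siteG_pos hl (hr.trans hx)).le
  have hlim : Tendsto (fun s => -siteF l s) atTop (nhds 0) := by
    simpa using (tendsto_siteF_atTop (l := l)).neg
  have hI := integrableOn_Ioi_deriv_of_nonneg' hd hpos hlim
  have h := integral_Ioi_of_hasDerivAt_of_nonneg' hd hpos hlim
  rw [← ofReal_integral_eq_lintegral_ofReal hI
    ((ae_restrict_iff' measurableSet_Ioi).2 (ae_of_all _ hpos)), h]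
  simp

lemma siteF_exp_le {l r η : ℝ} (hl : 0 < l) (hr : 0 < r) :
    siteF (l * Real.exp η) r ≤ siteF l r + (Real.exp η - 1) * siteP l r := by
  have h1 := exp_sub_one_pos hr
  have h2 : 0 < 1 + l / (Real.exp r - 1) := by positivity
  have h3 : 0 < 1 + l * Real.exp η / (Real.exp r - 1) := by
    have := Real.exp_pos η
    positivity
  have h := Real.log_le_sub_one_of_pos (div_pos h3 h2)
  rw [Real.log_div h3.ne' h2.ne'] at h
  unfold siteF
  refine sub_le_iff_le_add'.1 (h.trans_eq ?_)
  rw [siteP_eq hl hr]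
  have h6 : Real.exp r - 1 + l ≠ 0 := by positivity
  have h7 : 1 + l / (Real.exp r - 1) = (Real.exp r - 1 + l) / (Real.exp r - 1) := by
    field_simp
  rw [h7]
  field_simp
  ring

lemma lintegral_quadrant {φ h : ℝ → ENNReal} (hφ : Measurable φ) (hh : Measurable h) :
    ∫⁻ t : ℝ × ℝ in Set.Ioi (0:ℝ) ×ˢ Set.Ioi (0:ℝ), φ t.1 * h (t.1 + t.2) =
      ∫⁻ t in Set.Ioi (0:ℝ), φ t * ∫⁻ s in Set.Ioi t, h s := by
  rw [Measure.volume_eq_prod, ← Measure.prod_restrict, lintegral_prod _ (by fun_prop)]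
  refine lintegral_congr fun t => ?_
  simp only
  rw [lintegral_const_mul _ (by fun_prop)]
  congr 1
  rw [← lintegral_indicator measurableSet_Ioi, ← lintegral_indicator measurableSet_Ioi,
    ← lintegral_add_left_eq_self ((Set.Ioi t).indicator h) t]
  refine lintegral_congr fun s => ?_
  by_cases hs : 0 < s <;> simp [Set.indicator, hs]

lemma lintegral_triangle {φ h : ℝ → ENNReal} (hφ : Measurable φ) (hh : Measurable h) :
    ∫⁻ t in Set.Ioi (0:ℝ), φ t * ∫⁻ s in Set.Ioi t, h s =
      ∫⁻ s in Set.Ioi (0:ℝ), h s * ∫⁻ t in Set.Ioo 0 s, φ t := by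
  have hm : MeasurableSet {p : ℝ × ℝ | 0 < p.1 ∧ p.1 < p.2} := by measurability
  have h1 : ∫⁻ t in Set.Ioi (0:ℝ), φ t * ∫⁻ s in Set.Ioi t, h s =
      ∫⁻ t, ∫⁻ s, {p : ℝ × ℝ | 0 < p.1 ∧ p.1 < p.2}.indicator (fun p => φ p.1 * h p.2) (t, s) := by
    rw [← lintegral_indicator measurableSet_Ioi]
    refine lintegral_congr fun t => ?_
    by_cases ht : 0 < t
    · rw [Set.indicator_of_mem (by exact ht), ← lintegral_const_mul _ hh,
        ← lintegral_indicator measurableSet_Ioi]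
      refine lintegral_congr fun s => ?_
      simp [Set.indicator, ht]
    · rw [Set.indicator_of_notMem (by exact ht)]
      simp [Set.indicator, ht]
  rw [h1, lintegral_lintegral_swap]
  · rw [← lintegral_indicator measurableSet_Ioi]
    refine lintegral_congr fun s => ?_
    by_cases hs : 0 < s
    · rw [Set.indicator_of_mem (by exact hs), ← lintegral_const_mul _ hφ,
        ← lintegral_indicator measurableSet_Ioo]
      refine lintegral_congr fun t => ?_
      by_cases hst : 0 < t ∧ t < s
      · simp [Set.indicator, hst, mul_comm]
      · simp [Set.indicator, hst]
    · rw [Set.indicator_of_notMem (by exact hs)]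
      simp only [not_lt] at hs
      rw [lintegral_eq_zero_iff (by fun_prop (disch := exact hm))]
      refine ae_of_all _ fun t => ?_
      simp only [Set.indicator, Set.mem_ofPred_eq, Pi.zero_apply, ite_eq_right_iff]
      intro hh
      linarith
  · exact (Measurable.indicator (by fun_prop) hm).aemeasurable

lemma integrableOn_of_le_mul_div {u : ℝ → ℝ} {l : ℝ} (hl : 0 < l) (hu : Measurable u)
    (h0 : ∀ t, 0 < t → 0 ≤ u t) (h : ∀ t, 0 < t → u t ≤ l / (Real.exp t - 1)) :
    IntegrableOn (fun t => t * u t) (Set.Ioi 0) := by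
  have hE : IntegrableOn (fun t : ℝ => l * Real.exp (-(1 / 2) * t)) (Set.Ioi 0) :=
    (exp_neg_integrableOn_Ioi 0 (by norm_num : (0 : ℝ) < 1 / 2)).const_mul l
  refine Integrable.mono' hE (by fun_prop) ?_
  refine (ae_restrict_iff' measurableSet_Ioi).2 (ae_of_all _ fun t ht => ?_)
  have ht : 0 < t := ht
  rw [Real.norm_of_nonneg (mul_nonneg ht.le (h0 t ht))]
  exact (mul_le_mul_of_nonneg_left (h t ht) ht.le).trans (mul_div_exp_sub_one_le hl ht)

lemma integrableOn_mul_siteF {l : ℝ} (hl : 0 < l) :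
    IntegrableOn (fun t => t * siteF l t) (Set.Ioi 0) :=
  integrableOn_of_le_mul_div hl (measurable_siteF l) (fun _ ht => siteF_nonneg hl ht)
    fun _ ht => siteF_le hl ht

lemma integrableOn_mul_siteP {l : ℝ} (hl : 0 < l) :
    IntegrableOn (fun t => t * siteP l t) (Set.Ioi 0) :=
  integrableOn_of_le_mul_div hl (measurable_siteP l) (fun _ ht => (siteP_pos hl ht).le)
    fun _ ht => siteP_le hl ht

lemma Aint_eq {l : ℝ} (hl : 0 < l) : Aint l = ∫ t in Set.Ioi (0:ℝ), t * siteF l t := by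
  have e : ∀ t : ℝ × ℝ, t ∈ Set.Ioi (0:ℝ) ×ˢ Set.Ioi (0:ℝ) →
      l * t.1 * Real.exp (-(t.1 + t.2)) /
        ((1 - Real.exp (-(t.1 + t.2))) * (1 + (l - 1) * Real.exp (-(t.1 + t.2))))
      = t.1 * siteG l (t.1 + t.2) := by
    intro t _; unfold siteG; ring
  have hQ : MeasurableSet (Set.Ioi (0:ℝ) ×ˢ Set.Ioi (0:ℝ)) := measurableSet_Ioi.prod measurableSet_Ioi
  have hmG := measurable_siteG l
  have hmF := measurable_siteF l
  unfold Aint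
  rw [setIntegral_congr_fun hQ e, integral_eq_lintegral_of_nonneg_ae,
    integral_eq_lintegral_of_nonneg_ae]
  · congr 1
    have := lintegral_quadrant (φ := ENNReal.ofReal) (h := fun s => ENNReal.ofReal (siteG l s))
      (by fun_prop) (by fun_prop)
    rw [setLIntegral_congr_fun (g := fun t : ℝ × ℝ => ENNReal.ofReal t.1 *
      ENNReal.ofReal (siteG l (t.1 + t.2))) hQ
      (fun t ht => ENNReal.ofReal_mul (le_of_lt ht.1)), this]
    refine setLIntegral_congr_fun measurableSet_Ioi fun t ht => ?_
    rw [lintegral_Ioi_siteG hl ht, ENNReal.ofReal_mul (le_of_lt ht)]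
  · exact (ae_restrict_iff' measurableSet_Ioi).2
      (ae_of_all _ fun t ht => mul_nonneg (le_of_lt ht) (siteF_nonneg hl ht))
  · exact (by fun_prop : Measurable fun t => t * siteF l t).aestronglyMeasurable
  · exact (ae_restrict_iff' hQ).2 (ae_of_all _ fun t ht => mul_nonneg (le_of_lt ht.1)
      (siteG_pos hl (add_pos ht.1 ht.2)).le)
  · exact (by fun_prop : Measurable fun t : ℝ × ℝ => t.1 * siteG l (t.1 + t.2)).aestronglyMeasurable

lemma Bint_eq {l : ℝ} (hl : 0 < l) : Bint l = ∫ t in Set.Ioi (0:ℝ), t * siteP l t := by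
  have hQ : MeasurableSet (Set.Ioi (0:ℝ) ×ˢ Set.Ioi (0:ℝ)) := measurableSet_Ioi.prod measurableSet_Ioi
  have hmP := measurable_siteP l
  have e : Bint l = ∫ t : ℝ × ℝ in Set.Ioi (0:ℝ) ×ˢ Set.Ioi (0:ℝ), siteP l (t.1 + t.2) := rfl
  rw [e, integral_eq_lintegral_of_nonneg_ae, integral_eq_lintegral_of_nonneg_ae]
  · congr 1
    have := lintegral_quadrant (φ := fun _ => 1) (h := fun s => ENNReal.ofReal (siteP l s))
      (by fun_prop) (by fun_prop)
    simp only [one_mul] at this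
    have h2 := lintegral_triangle (φ := fun _ => 1) (h := fun s => ENNReal.ofReal (siteP l s))
      (by fun_prop) (by fun_prop)
    simp only [one_mul] at h2
    rw [this, h2]
    refine setLIntegral_congr_fun measurableSet_Ioi fun t ht => ?_
    simp only [lintegral_const, Measure.restrict_apply_univ, Real.volume_Ioo, sub_zero, one_mul]
    rw [ENNReal.ofReal_mul (le_of_lt ht), mul_comm]
  · exact (ae_restrict_iff' measurableSet_Ioi).2
      (ae_of_all _ fun t ht => mul_nonneg (le_of_lt ht) (siteP_pos hl ht).le)
  · exact (by fun_prop : Measurable fun t => t * siteP l t).aestronglyMeasurable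
  · exact (ae_restrict_iff' hQ).2 (ae_of_all _ fun t ht => (siteP_pos hl (add_pos ht.1 ht.2)).le)
  · exact (by fun_prop : Measurable fun t : ℝ × ℝ => siteP l (t.1 + t.2)).aestronglyMeasurable

lemma siteF_pos {l s : ℝ} (hl : 0 < l) (hs : 0 < s) : 0 < siteF l s := by
  have h1 := exp_sub_one_pos hs
  exact Real.log_pos (by have : 0 < l / (Real.exp s - 1) := by positivity
                         linarith)

lemma setIntegral_Ioi_pos {u : ℝ → ℝ} (hi : IntegrableOn (fun t => t * u t) (Set.Ioi 0))
    (hu : ∀ t, 0 < t → 0 < u t) : 0 < ∫ t in Set.Ioi (0:ℝ), t * u t := by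
  rw [setIntegral_pos_iff_support_of_nonneg_ae _ hi]
  · have : Function.support (fun t => t * u t) ∩ Set.Ioi 0 = Set.Ioi 0 := by
      refine Set.inter_eq_right.2 fun t ht => ?_
      exact (mul_pos ht (hu t ht)).ne'
    rw [this]
    simp
  · exact (ae_restrict_iff' measurableSet_Ioi).2
      (ae_of_all _ fun t ht => mul_nonneg (le_of_lt ht) (hu t ht).le)

lemma Aint_pos {l : ℝ} (hl : 0 < l) : 0 < Aint l := by
  rw [Aint_eq hl]
  exact setIntegral_Ioi_pos (integrableOn_mul_siteF hl) fun t ht => siteF_pos hl ht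

lemma Bint_pos {l : ℝ} (hl : 0 < l) : 0 < Bint l := by
  rw [Bint_eq hl]
  exact setIntegral_Ioi_pos (integrableOn_mul_siteP hl) fun t ht => siteP_pos hl ht

lemma Aint_mul_exp_le {l : ℝ} (hl : 0 < l) (η : ℝ) :
    Aint (l * Real.exp η) ≤ Aint l + (Real.exp η - 1) * Bint l := by
  have hl' : 0 < l * Real.exp η := by positivity
  rw [Aint_eq hl, Aint_eq hl', Bint_eq hl, ← integral_const_mul, ← integral_add
    (integrableOn_mul_siteF hl) ((integrableOn_mul_siteP hl).const_mul _)]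
  refine setIntegral_mono_on (integrableOn_mul_siteF hl')
    ((integrableOn_mul_siteF hl).add ((integrableOn_mul_siteP hl).const_mul _))
    measurableSet_Ioi fun t ht => ?_
  have := mul_le_mul_of_nonneg_left (siteF_exp_le (η := η) hl ht) (le_of_lt ht)
  linarith

lemma lintegral_siteG_mul_sq {l : ℝ} (hl : 0 < l) :
    ∫⁻ s in Set.Ioi (0:ℝ), ENNReal.ofReal (siteG l s) * ENNReal.ofReal (s ^ 2) =
      ENNReal.ofReal (2 * Aint l) := by
  have hmG := measurable_siteG l
  have h1 := lintegral_triangle (φ := ENNReal.ofReal) (h := fun s => ENNReal.ofReal (siteG l s))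
      (by fun_prop) (by fun_prop)
  have h2 : ∫⁻ t in Set.Ioi (0:ℝ), ENNReal.ofReal t * ∫⁻ s in Set.Ioi t, ENNReal.ofReal (siteG l s)
      = ENNReal.ofReal (Aint l) := by
    rw [Aint_eq hl, ofReal_integral_eq_lintegral_ofReal (integrableOn_mul_siteF hl)]
    · refine setLIntegral_congr_fun measurableSet_Ioi fun t ht => ?_
      rw [lintegral_Ioi_siteG hl ht, ENNReal.ofReal_mul (le_of_lt ht)]
    · exact (ae_restrict_iff' measurableSet_Ioi).2
        (ae_of_all _ fun t ht => mul_nonneg (le_of_lt ht) (siteF_nonneg hl ht))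
  rw [ENNReal.ofReal_mul zero_le_two, ← h2, h1, ← lintegral_const_mul' _ _ (by simp)]
  refine setLIntegral_congr_fun measurableSet_Ioi fun s hs => ?_
  have hs : 0 < s := hs
  have h3 : ∫⁻ t in Set.Ioo 0 s, ENNReal.ofReal t = ENNReal.ofReal (s ^ 2 / 2) := by
    rw [← ofReal_integral_eq_lintegral_ofReal]
    · rw [← integral_Ioc_eq_integral_Ioo, ← intervalIntegral.integral_of_le hs.le, integral_id]
      simp
    · exact (continuous_id.integrableOn_Icc).mono_set Set.Ioo_subset_Icc_self
    · exact (ae_restrict_iff' measurableSet_Ioo).2 (ae_of_all _ fun t ht => ht.1.le)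
  rw [h3, mul_left_comm, ← ENNReal.ofReal_mul zero_le_two]
  congr 2
  ring

lemma one_le_xnorm (x : Xc) : 1 ≤ xnorm x := by
  unfold xnorm
  rw [Real.one_le_sqrt]
  have : 1 ≤ x.1.1 ^ 2 + x.1.2 ^ 2 := by
    by_contra hc
    have ha : x.1.1 = 0 := by nlinarith [sq_nonneg x.1.2]
    have hb : x.1.2 = 0 := by nlinarith [sq_nonneg x.1.1]
    have := x.2
    rw [ha, hb] at this
    simp at this
  exact_mod_cast this

lemma xnorm_pos (x : Xc) : 0 < xnorm x := zero_lt_one.trans_le (one_le_xnorm x)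

lemma finite_xnorm_lt (R : ℝ) : {x : Xc | xnorm x < R}.Finite := by
  refine Set.Finite.of_injOn (f := Subtype.val) (t := {p : ℕ × ℕ | (p.1 : ℝ) ^ 2 + (p.2 : ℝ) ^ 2 < R ^ 2})
    ?_ Subtype.val_injective.injOn (finite_lattice R)
  intro x hx
  have hx : xnorm x < R := hx
  have hR : 0 < R := (xnorm_pos x).trans hx
  rw [xnorm, Real.sqrt_lt' hR] at hx
  exact hx

/-- Logarithm of the partition function. -/
noncomputable def logZ (l b : ℝ) : ℝ := ∑' x : Xc, siteF l (b * xnorm x)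

lemma tsum_ofReal_siteF {l b : ℝ} (hl : 0 < l) (hb : 0 < b) :
    ∑' x : Xc, ENNReal.ofReal (siteF l (b * xnorm x)) =
      ∫⁻ s in Set.Ioi (0:ℝ), ENNReal.ofReal (siteG l s) * ENNReal.ofReal (primCount (s / b)) := by
  have hmG := measurable_siteG l
  have hmG' : Measurable fun s => ENNReal.ofReal (siteG l s) := by fun_prop
  have h1 : ∀ x : Xc, ENNReal.ofReal (siteF l (b * xnorm x)) =
      ∫⁻ s in Set.Ioi (0:ℝ), (Set.Ioi (b * xnorm x)).indicator
        (fun s => ENNReal.ofReal (siteG l s)) s := by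
    intro x
    have hx : 0 < b * xnorm x := mul_pos hb (xnorm_pos x)
    rw [← lintegral_Ioi_siteG hl hx, lintegral_indicator measurableSet_Ioi,
      Measure.restrict_restrict measurableSet_Ioi,
      Set.inter_eq_left.2 (Set.Ioi_subset_Ioi hx.le)]
  simp_rw [h1]
  rw [← lintegral_tsum fun x => (hmG'.indicator measurableSet_Ioi).aemeasurable]
  refine setLIntegral_congr_fun measurableSet_Ioi fun s _ => ?_
  have h2 : ∀ x : Xc, (Set.Ioi (b * xnorm x)).indicator (fun s => ENNReal.ofReal (siteG l s)) s =
      {x : Xc | xnorm x < s / b}.indicator (fun _ => ENNReal.ofReal (siteG l s)) x := by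
    intro x
    simp only [Set.indicator, Set.mem_Ioi, Set.mem_ofPred_eq, lt_div_iff₀ hb, mul_comm b]
  simp_rw [h2]
  rw [← tsum_subtype {x : Xc | xnorm x < s / b} (fun _ => ENNReal.ofReal (siteG l s)),
    ENNReal.tsum_const, mul_comm]
  congr 1
  have := (finite_xnorm_lt (s / b)).to_subtype
  rw [ENat.card_eq_coe_natCard, ENat.toENNReal_coe, ENNReal.ofReal_natCast]
  rfl

lemma tendsto_lintegral_siteG_primCount {l : ℝ} (hl : 0 < l) :
    Tendsto (fun b : ℝ => ∫⁻ s in Set.Ioi (0:ℝ), ENNReal.ofReal (siteG l s) *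
      ENNReal.ofReal (b ^ 2 * primCount (s / b))) (nhdsWithin 0 (Set.Ioi 0))
      (nhds (ENNReal.ofReal (π / 2 * Aint l / zeta2))) := by
  have hz : 0 < zeta2 := by unfold zeta2; positivity
  have hmG := measurable_siteG l
  have hmC : Measurable fun R => (primCount R : ℝ) := by
    have : Monotone fun R => (primCount R : ℝ) := by
      intro R S h
      have : primCount R ≤ primCount S :=
        Nat.card_mono (finite_xnorm_lt S) fun x (hx : xnorm x < R) => hx.trans_le h
      exact Nat.cast_le.2 this
    exact this.measurable
  have hlim : ENNReal.ofReal (π / 2 * Aint l / zeta2) = ∫⁻ s in Set.Ioi (0:ℝ),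
      ENNReal.ofReal (siteG l s) * ENNReal.ofReal (s ^ 2 * (π / (4 * zeta2))) := by
    have h1 := lintegral_siteG_mul_sq hl
    have h2 : ∀ s : ℝ, ENNReal.ofReal (siteG l s) * ENNReal.ofReal (s ^ 2 * (π / (4 * zeta2))) =
        (ENNReal.ofReal (siteG l s) * ENNReal.ofReal (s ^ 2)) * ENNReal.ofReal (π / (4 * zeta2)) := by
      intro s
      rw [ENNReal.ofReal_mul (sq_nonneg s), mul_assoc]
    simp_rw [h2]
    rw [lintegral_mul_const' _ _ (by simp), h1, ← ENNReal.ofReal_mul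
      (by have := Aint_pos hl; positivity)]
    congr 1
    field_simp
    ring
  rw [hlim]
  refine tendsto_lintegral_filter_of_dominated_convergence
    (fun s => ENNReal.ofReal (siteG l s) * ENNReal.ofReal (s ^ 2) * 4) ?_ ?_ ?_ ?_
  · refine Eventually.of_forall fun b => ?_
    have hmC' : Measurable fun s => (primCount (s / b) : ℝ) := hmC.comp (measurable_id.div_const b)
    fun_prop
  · filter_upwards [self_mem_nhdsWithin] with b hb
    have hb : 0 < b := hb
    refine (ae_restrict_iff' measurableSet_Ioi).2 (ae_of_all _ fun s hs => ?_)
    have hs : 0 < s := hs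
    rw [mul_assoc]
    gcongr
    have h4 : (4 : ENNReal) = ENNReal.ofReal 4 := by norm_num
    rw [h4, ← ENNReal.ofReal_mul (sq_nonneg s)]
    refine ENNReal.ofReal_le_ofReal ?_
    have := primCount_le (R := s / b) (by positivity)
    calc b ^ 2 * (primCount (s / b) : ℝ) ≤ b ^ 2 * (4 * (s / b) ^ 2) := by gcongr
      _ = s ^ 2 * 4 := by field_simp
  · rw [lintegral_mul_const' _ _ (by simp), lintegral_siteG_mul_sq hl]
    exact ENNReal.mul_ne_top ENNReal.ofReal_ne_top (by simp)
  · refine (ae_restrict_iff' measurableSet_Ioi).2 (ae_of_all _ fun s hs => ?_)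
    have hs : 0 < s := hs
    refine ENNReal.Tendsto.const_mul ?_ (Or.inr ENNReal.ofReal_ne_top)
    refine ENNReal.tendsto_ofReal ?_
    have h1 : Tendsto (fun b : ℝ => s / b) (nhdsWithin 0 (Set.Ioi 0)) atTop :=
      (tendsto_inv_nhdsGT_zero (𝕜 := ℝ)).const_mul_atTop hs
    have h2 := (tendsto_primCount_div_sq.comp h1).const_mul (s ^ 2)
    refine h2.congr' ?_
    filter_upwards [self_mem_nhdsWithin] with b hb
    have hb : 0 < b := hb
    simp only [Function.comp]
    field_simp

lemma tsum_ofReal_siteF_ne_top {l b : ℝ} (hl : 0 < l) (hb : 0 < b) :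
    ∑' x : Xc, ENNReal.ofReal (siteF l (b * xnorm x)) ≠ ⊤ := by
  rw [tsum_ofReal_siteF hl hb]
  have hle : ∫⁻ s in Set.Ioi (0:ℝ), ENNReal.ofReal (siteG l s) * ENNReal.ofReal (primCount (s / b))
      ≤ ∫⁻ s in Set.Ioi (0:ℝ), ENNReal.ofReal (siteG l s) * ENNReal.ofReal (s ^ 2) *
        ENNReal.ofReal (4 / b ^ 2) := by
    refine setLIntegral_mono' measurableSet_Ioi fun s hs => ?_
    have hs : 0 < s := hs
    rw [mul_assoc, ← ENNReal.ofReal_mul (sq_nonneg s)]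
    gcongr
    refine (primCount_le (R := s / b) (by positivity)).trans_eq ?_
    field_simp
  refine ne_top_of_le_ne_top ?_ hle
  rw [lintegral_mul_const' _ _ (by simp), lintegral_siteG_mul_sq hl]
  exact ENNReal.mul_ne_top ENNReal.ofReal_ne_top ENNReal.ofReal_ne_top

lemma siteF_xnorm_nonneg {l b : ℝ} (hl : 0 < l) (hb : 0 < b) (x : Xc) :
    0 ≤ siteF l (b * xnorm x) := siteF_nonneg hl (mul_pos hb (xnorm_pos x))

lemma summable_siteF {l b : ℝ} (hl : 0 < l) (hb : 0 < b) :
    Summable fun x : Xc => siteF l (b * xnorm x) := by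
  have h := ENNReal.summable_toReal (tsum_ofReal_siteF_ne_top hl hb)
  refine h.congr fun x => ?_
  rw [ENNReal.toReal_ofReal (siteF_xnorm_nonneg hl hb x)]

/-- Asymptotics of the logarithm of the partition function as the inverse temperature tends to
zero. -/
lemma tendsto_sq_mul_logZ {l : ℝ} (hl : 0 < l) :
    Tendsto (fun b : ℝ => b ^ 2 * logZ l b) (nhdsWithin 0 (Set.Ioi 0))
      (nhds (π / 2 * Aint l / zeta2)) := by
  have hz : 0 < zeta2 := by unfold zeta2; positivity
  have hA := Aint_pos hl
  have h := (ENNReal.tendsto_toReal ENNReal.ofReal_ne_top).comp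
    (tendsto_lintegral_siteG_primCount hl)
  rw [ENNReal.toReal_ofReal (by positivity)] at h
  refine h.congr' ?_
  filter_upwards [self_mem_nhdsWithin] with b hb
  have hb : 0 < b := hb
  have h1 : ∀ s : ℝ, ENNReal.ofReal (siteG l s) * ENNReal.ofReal (b ^ 2 * primCount (s / b)) =
      ENNReal.ofReal (b ^ 2) * (ENNReal.ofReal (siteG l s) *
        ENNReal.ofReal (primCount (s / b))) := by
    intro s
    rw [ENNReal.ofReal_mul (sq_nonneg b), mul_left_comm]
  simp only [Function.comp, h1]
  rw [lintegral_const_mul' _ _ (by simp), ← tsum_ofReal_siteF hl hb, ENNReal.toReal_mul,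
    ENNReal.toReal_ofReal (sq_nonneg b), ENNReal.tsum_toReal_eq (fun _ => ENNReal.ofReal_ne_top)]
  congr 1
  refine tsum_congr fun x => ?_
  rw [ENNReal.toReal_ofReal (siteF_xnorm_nonneg hl hb x)]

/-- Chains supported on `T` with multiplicities at most `M`. -/
noncomputable def boxChains (T : Finset Xc) (M : ℕ) : Finset (Xc →₀ ℕ) :=
  T.finsupp fun _ => Finset.range (M + 1)

/-- Gibbs weight of a chain. -/
noncomputable def weight (l b : ℝ) (ν : Xc →₀ ℕ) : ℝ :=
  l ^ ν.support.card * Real.exp (-(b * totalLength ν))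

lemma weight_nonneg {l : ℝ} (hl : 0 < l) (b : ℝ) (ν : Xc →₀ ℕ) : 0 ≤ weight l b ν := by
  unfold weight; positivity

lemma totalLength_eq_sum {ν : Xc →₀ ℕ} {T : Finset Xc} (h : ν.support ⊆ T) :
    totalLength ν = ∑ x ∈ T, (ν x : ℝ) * xnorm x := by
  unfold totalLength
  rw [Finsupp.sum_of_support_subset ν h _ (by simp)]
  rfl

/-- Truncated one-site partition function. -/
noncomputable def siteZ (l : ℝ) (M : ℕ) (r : ℝ) : ℝ :=
  1 + l * ∑ k ∈ Finset.range M, Real.exp (-r) ^ (k + 1)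

lemma weight_eq_prod {l b : ℝ} {ν : Xc →₀ ℕ} {T : Finset Xc} (h : ν.support ⊆ T) :
    weight l b ν = ∏ x ∈ T, if ν x = 0 then 1 else l * Real.exp (-(b * xnorm x)) ^ (ν x) := by
  have h1 : ∀ x ∈ T, (if ν x = 0 then (1 : ℝ) else l * Real.exp (-(b * xnorm x)) ^ (ν x)) =
      (if ν x ≠ 0 then l else 1) * Real.exp (-(b * ((ν x : ℝ) * xnorm x))) := by
    intro x _
    by_cases hx : ν x = 0
    · simp [hx]
    · simp only [hx, if_false, ne_eq, not_false_eq_true, if_true]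
      rw [← Real.exp_nat_mul]
      ring_nf
  rw [Finset.prod_congr rfl h1, Finset.prod_mul_distrib, ← Finset.prod_filter, Finset.prod_const,
    ← Real.exp_sum, weight, totalLength_eq_sum h]
  congr 2
  · congr 1
    ext x
    simp only [Finsupp.mem_support_iff, Finset.mem_filter]
    exact ⟨fun hx => ⟨h (Finsupp.mem_support_iff.2 hx), hx⟩, fun hx => hx.2⟩
  · rw [Finset.sum_neg_distrib, Finset.mul_sum]

lemma sum_weight_boxChains (l b : ℝ) (T : Finset Xc) (M : ℕ) :
    ∑ ν ∈ boxChains T M, weight l b ν = ∏ x ∈ T, siteZ l M (b * xnorm x) := by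
  have h1 : ∑ ν ∈ boxChains T M, weight l b ν = ∑ ν ∈ boxChains T M,
      ∏ x ∈ T, if ν x = 0 then 1 else l * Real.exp (-(b * xnorm x)) ^ (ν x) :=
    Finset.sum_congr rfl fun ν hν => weight_eq_prod (Finset.mem_finsupp_iff.1 hν).1
  have h2 : ∀ x ∈ T, siteZ l M (b * xnorm x) = ∑ k ∈ Finset.range (M + 1),
      if k = 0 then 1 else l * Real.exp (-(b * xnorm x)) ^ k := by
    intro x _
    rw [Finset.sum_range_succ']
    simp [siteZ, Finset.mul_sum, add_comm]
  rw [h1, Finset.prod_congr rfl h2, boxChains, Finset.finsupp, Finset.sum_map]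
  classical
  rw [Finset.prod_sum]
  refine Finset.sum_congr (by ext; simp [Finset.mem_pi]) fun p hp => ?_
  rw [← Finset.prod_attach]
  refine Finset.prod_congr rfl fun x _ => ?_
  simp [Finsupp.indicator_of_mem x.2]

lemma one_le_siteZ {l : ℝ} (hl : 0 < l) (M : ℕ) (r : ℝ) : 1 ≤ siteZ l M r := by
  have : 0 ≤ l * ∑ k ∈ Finset.range M, Real.exp (-r) ^ (k + 1) := by positivity
  unfold siteZ; linarith

lemma exp_siteF {l r : ℝ} (hl : 0 < l) (hr : 0 < r) :
    Real.exp (siteF l r) = 1 + l / (Real.exp r - 1) := by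
  have := exp_sub_one_pos hr
  unfold siteF
  rw [Real.exp_log (by positivity)]

lemma hasSum_siteZ {r : ℝ} (hr : 0 < r) :
    HasSum (fun k : ℕ => Real.exp (-r) ^ (k + 1)) (1 / (Real.exp r - 1)) := by
  have h1 : Real.exp (-r) < 1 := Real.exp_lt_one_iff.2 (neg_lt_zero.2 hr)
  have h := (hasSum_geometric_of_lt_one (Real.exp_pos _).le h1).mul_left (Real.exp (-r))
  have h2 := exp_sub_one_pos hr
  have e1 : (fun k : ℕ => Real.exp (-r) ^ (k + 1)) =
      fun k => Real.exp (-r) * Real.exp (-r) ^ k := by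
    funext k; ring
  have e2 : 1 / (Real.exp r - 1) = Real.exp (-r) * (1 - Real.exp (-r))⁻¹ := by
    rw [Real.exp_neg]
    have h3 := Real.exp_pos r
    have h4 : 1 - (Real.exp r)⁻¹ = (Real.exp r - 1) / Real.exp r := by field_simp
    rw [h4]
    field_simp
  rw [e1, e2]
  exact h

lemma siteZ_le {l r : ℝ} (hl : 0 < l) (hr : 0 < r) (M : ℕ) :
    siteZ l M r ≤ Real.exp (siteF l r) := by
  rw [exp_siteF hl hr, siteZ]
  have h := hasSum_siteZ hr
  have := sum_le_hasSum (Finset.range M) (fun k _ => by positivity) h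
  have h2 := mul_le_mul_of_nonneg_left this hl.le
  rw [mul_one_div] at h2
  linarith

lemma tendsto_siteZ {l r : ℝ} (hl : 0 < l) (hr : 0 < r) :
    Tendsto (fun M => siteZ l M r) atTop (nhds (Real.exp (siteF l r))) := by
  rw [exp_siteF hl hr]
  have h := ((hasSum_siteZ hr).tendsto_sum_nat.const_mul l).const_add 1
  rw [mul_one_div] at h
  exact h

lemma sum_weight_le_exp_sum {l b : ℝ} (hl : 0 < l) (hb : 0 < b) (T : Finset Xc) (M : ℕ) :
    ∑ ν ∈ boxChains T M, weight l b ν ≤ Real.exp (∑ x ∈ T, siteF l (b * xnorm x)) := by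
  rw [sum_weight_boxChains, Real.exp_sum]
  exact Finset.prod_le_prod (fun x _ => zero_le_one.trans (one_le_siteZ hl M _))
    fun x _ => siteZ_le hl (mul_pos hb (xnorm_pos x)) M

/-- Logarithm of the partition function with the sites of `U` removed. -/
noncomputable def logZOff (U : Finset Xc) (l b : ℝ) : ℝ :=
  logZ l b - ∑ x ∈ U, siteF l (b * xnorm x)

lemma sum_siteF_le_logZOff {l b : ℝ} (hl : 0 < l) (hb : 0 < b) {T U : Finset Xc}
    (hTU : Disjoint T U) : ∑ x ∈ T, siteF l (b * xnorm x) ≤ logZOff U l b := by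
  unfold logZOff logZ
  rw [le_sub_iff_add_le, ← Finset.sum_disjUnion hTU]
  exact (summable_siteF hl hb).sum_le_tsum _ fun x _ => siteF_xnorm_nonneg hl hb x

lemma sum_weight_le {l b : ℝ} (hl : 0 < l) (hb : 0 < b) {T U : Finset Xc}
    (hTU : Disjoint T U) (M : ℕ) :
    ∑ ν ∈ boxChains T M, weight l b ν ≤ Real.exp (logZOff U l b) :=
  (sum_weight_le_exp_sum hl hb T M).trans (Real.exp_le_exp.2 (sum_siteF_le_logZOff hl hb hTU))

lemma exists_le_sum_weight {l b : ℝ} (hl : 0 < l) (hb : 0 < b) (U : Finset Xc) :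
    ∃ T M, Disjoint T U ∧
      Real.exp (logZOff U l b - 1) ≤ ∑ ν ∈ boxChains T M, weight l b ν := by
  classical
  have h1 := (summable_siteF hl hb).hasSum
  have h2 : ∀ᶠ V : Finset Xc in atTop, logZ l b - 1 < ∑ x ∈ V, siteF l (b * xnorm x) :=
    h1.eventually_const_lt (sub_one_lt _)
  obtain ⟨V, hV, hUV⟩ := (h2.and (eventually_ge_atTop U)).exists
  have hsum : logZOff U l b - 1 < ∑ x ∈ V \ U, siteF l (b * xnorm x) := by
    have := Finset.sum_sdiff (f := fun x : Xc => siteF l (b * xnorm x)) hUV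
    unfold logZOff
    linarith
  have h3 : Tendsto (fun M => ∏ x ∈ V \ U, siteZ l M (b * xnorm x)) atTop
      (nhds (∏ x ∈ V \ U, Real.exp (siteF l (b * xnorm x)))) :=
    tendsto_finsetProd _ fun x _ => tendsto_siteZ hl (mul_pos hb (xnorm_pos x))
  rw [← Real.exp_sum] at h3
  obtain ⟨M, hM⟩ := (h3.eventually_const_lt (Real.exp_lt_exp.2 hsum)).exists
  refine ⟨V \ U, M, Finset.sdiff_disjoint, ?_⟩
  rw [sum_weight_boxChains]
  exact hM.le

lemma totalLength_nonneg (ν : Xc →₀ ℕ) : 0 ≤ totalLength ν := by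
  rw [totalLength_eq_sum subset_rfl]
  exact Finset.sum_nonneg fun x _ => mul_nonneg (Nat.cast_nonneg _) (xnorm_pos x).le

lemma mem_boxChains_of_totalLength_lt {ν : Xc →₀ ℕ} {n : ℕ} (h : totalLength ν < n) :
    ν ∈ boxChains (finite_xnorm_lt n).toFinset n := by
  have key : ∀ x, (ν x : ℝ) * xnorm x ≤ totalLength ν := by
    intro x
    by_cases hx : x ∈ ν.support
    · rw [totalLength_eq_sum subset_rfl]
      exact Finset.single_le_sum (f := fun x => (ν x : ℝ) * xnorm x)
        (fun x _ => mul_nonneg (Nat.cast_nonneg _) (xnorm_pos x).le) hx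
    · rw [Finsupp.notMem_support_iff.1 hx]
      simpa using totalLength_nonneg ν
  rw [boxChains, Finset.mem_finsupp_iff]
  refine ⟨fun x hx => ?_, fun x _ => ?_⟩
  · simp only [Set.Finite.mem_toFinset, Set.mem_ofPred_eq]
    have h1 : (1 : ℝ) ≤ ν x := by
      exact_mod_cast Nat.one_le_iff_ne_zero.2 (Finsupp.mem_support_iff.1 hx)
    have := key x
    nlinarith [xnorm_pos x]
  · rw [Finset.mem_range]
    have := key x
    have h2 : (ν x : ℝ) < n := by
      have := one_le_xnorm x
      have h3 : (0 : ℝ) ≤ ν x := Nat.cast_nonneg _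
      nlinarith
    have : ν x < n := by exact_mod_cast h2
    omega

/-- The unit vector `(1, 0)`. -/
def unitVec : Xc := ⟨(1, 0), by norm_num⟩

lemma xnorm_unitVec : xnorm unitVec = 1 := by simp [xnorm, unitVec]

/-- Extending free chains by sites of a reserved set `Q` and by multiples of `(1, 0)` adjusts the
number of vertices and the total length. -/
lemma card_le_numChainsLen {n N : ℕ} {ℓ : ℝ} {Q T : Finset Xc} {M : ℕ} {G : Finset (Xc →₀ ℕ)}
    (hQ : unitVec ∉ Q) (hT : Disjoint T (insert unitVec Q)) (hG : G ⊆ boxChains T M)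
    (hlen : ∀ ν ∈ G, totalLength ν ≤ ℓ) (hN : ∀ ν ∈ G, ν.support.card + 1 ≤ N)
    (hN' : ∀ ν ∈ G, N ≤ ν.support.card + 1 + Q.card)
    (hℓ : ℓ + ∑ x ∈ Q, xnorm x + 1 ≤ n) : G.card ≤ numChainsLen n N := by
  classical
  have hS : ∀ ν : Xc →₀ ℕ, ∃ S : Finset Xc, ν ∈ G → S ⊆ Q ∧ S.card = N - 1 - ν.support.card := by
    intro ν
    by_cases hν : ν ∈ G
    · obtain ⟨S, hS⟩ := Finset.exists_subset_card_eq (s := Q) (n := N - 1 - ν.support.card)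
        (by have := hN' ν hν; omega)
      exact ⟨S, fun _ => hS⟩
    · exact ⟨∅, fun h => absurd h hν⟩
  choose S hS using hS
  let m : (Xc →₀ ℕ) → ℕ := fun ν => ⌈(n : ℝ) - totalLength ν - ∑ x ∈ S ν, xnorm x⌉₊
  let F : (Xc →₀ ℕ) → (Xc →₀ ℕ) := fun ν => Finsupp.onFinset (insert unitVec (S ν ∪ ν.support))
    (fun x => if x = unitVec then m ν else if x ∈ S ν then 1 else ν x) (by
      intro x hx
      simp only [Finset.mem_insert, Finset.mem_union, Finsupp.mem_support_iff]
      by_contra hc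
      push Not at hc
      simp [hc.1, hc.2.1, hc.2.2] at hx)
  have hfree : ∀ ν ∈ G, ∀ x ∈ insert unitVec Q, ν x = 0 := by
    intro ν hν x hx
    by_contra hc
    exact Finset.disjoint_left.1 hT
      ((Finset.mem_finsupp_iff.1 (hG hν)).1 (Finsupp.mem_support_iff.2 hc)) hx
  have hsumS : ∀ ν ∈ G, ∑ x ∈ S ν, xnorm x ≤ ∑ x ∈ Q, xnorm x := fun ν hν =>
    Finset.sum_le_sum_of_subset_of_nonneg (hS ν hν).1 fun x _ _ => (xnorm_pos x).le
  have hmpos : ∀ ν ∈ G, 0 < m ν := by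
    intro ν hν
    refine Nat.ceil_pos.2 ?_
    have := hsumS ν hν
    have := hlen ν hν
    linarith
  have hdisj : ∀ ν ∈ G, Disjoint (S ν) ν.support := by
    intro ν hν
    refine Finset.disjoint_left.2 fun x hx hx' => ?_
    exact Finsupp.mem_support_iff.1 hx'
      (hfree ν hν x (Finset.mem_insert_of_mem ((hS ν hν).1 hx)))
  have hnot : ∀ ν ∈ G, unitVec ∉ S ν ∪ ν.support := by
    intro ν hν hc
    rcases Finset.mem_union.1 hc with h | h
    · exact hQ ((hS ν hν).1 h)
    · exact Finsupp.mem_support_iff.1 h (hfree ν hν _ (Finset.mem_insert_self _ _))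
  have hsupp : ∀ ν ∈ G, (F ν).support = insert unitVec (S ν ∪ ν.support) := by
    intro ν hν
    refine Finset.Subset.antisymm Finsupp.support_onFinset_subset fun x hx => ?_
    rw [Finsupp.mem_support_iff]
    simp only [F, Finsupp.onFinset_apply]
    by_cases h1 : x = unitVec
    · simp only [h1, if_true]; exact (hmpos ν hν).ne'
    · by_cases h2 : x ∈ S ν
      · simp [h1, h2]
      · simp only [h1, h2, if_false]
        simpa [h1, h2] using hx
  have hcard : ∀ ν ∈ G, (F ν).support.card = N := by
    intro ν hν
    rw [hsupp ν hν, Finset.card_insert_of_notMem (hnot ν hν),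
      Finset.card_union_of_disjoint (hdisj ν hν), (hS ν hν).2]
    have := hN ν hν
    omega
  have hlength : ∀ ν ∈ G, totalLength (F ν) = m ν + (∑ x ∈ S ν, xnorm x + totalLength ν) := by
    intro ν hν
    rw [totalLength_eq_sum (hsupp ν hν).subset, Finset.sum_insert (hnot ν hν),
      Finset.sum_union (hdisj ν hν), totalLength_eq_sum (ν := ν) subset_rfl, xnorm_unitVec]
    congr 1
    · simp [F]
    · congr 1
      · refine Finset.sum_congr rfl fun x hx => ?_
        have : x ≠ unitVec := fun h => hQ (h ▸ (hS ν hν).1 hx)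
        simp [F, this, hx]
      · refine Finset.sum_congr rfl fun x hx => ?_
        have h1 : x ≠ unitVec := fun h => hnot ν hν (h ▸ Finset.mem_union_right _ hx)
        have h2 : x ∉ S ν := fun h => Finset.disjoint_left.1 (hdisj ν hν) h hx
        simp [F, h1, h2]
  have hfin : Finite {ν : Xc →₀ ℕ // totalLength ν ∈ Set.Ico (n : ℝ) ((n : ℝ) + 1) ∧
      ν.support.card = N} := by
    refine Set.Finite.to_subtype (Set.Finite.subset
      (boxChains (finite_xnorm_lt ((n + 1 : ℕ) : ℝ)).toFinset (n + 1)).finite_toSet ?_)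
    rintro ν ⟨h, _⟩
    exact mem_boxChains_of_totalLength_lt (by push_cast; exact h.2)
  rw [numChainsLen, ← Nat.card_eq_finsetCard]
  refine Nat.card_le_card_of_injective (fun ν : G => ⟨F ν.1, ?_, hcard ν.1 ν.2⟩) ?_
  · rw [hlength ν.1 ν.2]
    have hs := hsumS ν.1 ν.2
    have hl := hlen ν.1 ν.2
    have h1 := Nat.le_ceil ((n : ℝ) - totalLength ν.1 - ∑ x ∈ S ν.1, xnorm x)
    have h2 := Nat.ceil_lt_add_one
      (show 0 ≤ (n : ℝ) - totalLength ν.1 - ∑ x ∈ S ν.1, xnorm x by linarith)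
    constructor
    · simp only [m]; linarith
    · simp only [m]; linarith
  · rintro ⟨ν, hν⟩ ⟨ν', hν'⟩ h
    have h : F ν = F ν' := congrArg Subtype.val h
    refine Subtype.ext (Finsupp.ext fun x => ?_)
    simp only
    by_cases hx : x ∈ insert unitVec Q
    · rw [hfree ν hν x hx, hfree ν' hν' x hx]
    · have h1 : x ≠ unitVec := fun h => hx (h ▸ Finset.mem_insert_self _ _)
      have h2 : ∀ μ ∈ G, x ∉ S μ := fun μ hμ h =>
        hx (Finset.mem_insert_of_mem ((hS μ hμ).1 h))
      have := DFunLike.congr_fun h x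
      simpa [F, h1, h2 ν hν, h2 ν' hν'] using this

lemma siteF_add_le {l l' r r' η : ℝ} (hl : 0 < l) (hr : 0 < r) (hη : 0 ≤ η)
    (h : (1 + η) * (l / (Real.exp r - 1)) ≤ l' / (Real.exp r' - 1)) :
    siteF l r + (η * siteP l r - η ^ 2) ≤ siteF l' r' := by
  have h1 := exp_sub_one_pos hr
  have hp := siteP_pos hl hr
  have hp1 := siteP_le_one hl hr
  have hle : η * siteP l r ≤ η := by nlinarith
  have hnn : 0 ≤ η * siteP l r := by positivity
  have h2 : 0 < 1 + l / (Real.exp r - 1) := by positivity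
  have h3 : (1 + l / (Real.exp r - 1)) * (1 + η * siteP l r) ≤ 1 + l' / (Real.exp r' - 1) := by
    have : (1 + l / (Real.exp r - 1)) * (1 + η * siteP l r) =
        1 + (1 + η) * (l / (Real.exp r - 1)) := by
      rw [siteP_eq hl hr]
      field_simp
      ring
    linarith
  have h4 := Real.log_le_log (by positivity) h3
  rw [Real.log_mul h2.ne' (by positivity)] at h4
  have h5 : η * siteP l r - η ^ 2 ≤ Real.log (1 + η * siteP l r) := by
    refine le_trans ?_ (Real.one_sub_inv_le_log_of_pos (by positivity))
    have h6 : 1 - (1 + η * siteP l r)⁻¹ = η * siteP l r / (1 + η * siteP l r) := by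
      field_simp
      ring
    rw [h6, le_div_iff₀ (by positivity)]
    nlinarith [mul_le_mul hle hle hnn hη, mul_nonneg (sq_nonneg η) hnn]
  unfold siteF
  linarith

lemma siteF_add_le_siteF_mul_exp {l r η : ℝ} (hl : 0 < l) (hr : 0 < r) (hη : 0 ≤ η) :
    siteF l r + (η * siteP l r - η ^ 2) ≤ siteF (l * Real.exp η) r := by
  refine siteF_add_le hl hr hη ?_
  have h1 := exp_sub_one_pos hr
  have := Real.add_one_le_exp η
  rw [mul_div_right_comm, mul_comm]
  gcongr
  linarith

lemma siteF_add_le_siteF_one_sub_mul {l r η : ℝ} (hl : 0 < l) (hr : 0 < r) (hη : 0 ≤ η)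
    (hη1 : η < 1) : siteF l r + (η * siteP l r - η ^ 2) ≤ siteF l ((1 - η) * r) := by
  refine siteF_add_le hl hr hη ?_
  have h1 := exp_sub_one_pos hr
  have h2 := exp_sub_one_pos (mul_pos (sub_pos.2 hη1) hr)
  have h3 := convexOn_exp.2 (Set.mem_univ r) (Set.mem_univ 0) (sub_nonneg.2 hη1.le) hη (by ring)
  simp only [smul_eq_mul, mul_zero, add_zero, Real.exp_zero, mul_one] at h3
  rw [← mul_div_assoc, div_le_div_iff₀ h1 h2]
  have h4 : Real.exp ((1 - η) * r) - 1 ≤ (1 - η) * (Real.exp r - 1) := by linarith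
  have h5 : (1 + η) * (Real.exp ((1 - η) * r) - 1) ≤ Real.exp r - 1 := by
    nlinarith [mul_le_mul_of_nonneg_left h4 (by linarith : 0 ≤ 1 + η),
      mul_nonneg (sq_nonneg η) h1.le]
  nlinarith

lemma siteF_le_add_siteF_mul_exp_neg {l r η : ℝ} (hl : 0 < l) (hr : 0 < r) (hη : 0 ≤ η) :
    siteF l r ≤ siteF (l * Real.exp (-η)) r + η := by
  have h1 := exp_sub_one_pos hr
  have h2 : 0 < 1 + l * Real.exp (-η) / (Real.exp r - 1) := by positivity
  have h3 : 1 + l / (Real.exp r - 1) ≤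
      (1 + l * Real.exp (-η) / (Real.exp r - 1)) * Real.exp η := by
    have h4 : Real.exp (-η) * Real.exp η = 1 := by rw [← Real.exp_add]; simp
    have h5 : (1 + l * Real.exp (-η) / (Real.exp r - 1)) * Real.exp η =
        Real.exp η + l * (Real.exp (-η) * Real.exp η) / (Real.exp r - 1) := by ring
    rw [h5, h4, mul_one]
    have := Real.one_le_exp hη
    linarith
  have h4 := Real.log_le_log (by positivity) h3
  rwa [Real.log_mul h2.ne' (Real.exp_pos _).ne', Real.log_exp] at h4

/-- Chernoff bound: the Gibbs mass of a set of chains is controlled by tilting the parameters. -/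
lemma sum_weight_le_of_tilt {l b l' b' s : ℝ} (hl' : 0 < l') (hb' : 0 < b') {T U : Finset Xc}
    (hTU : Disjoint T U) {M : ℕ} {B : Finset (Xc →₀ ℕ)} (hB : B ⊆ boxChains T M)
    (h : ∀ ν ∈ B, weight l b ν ≤ Real.exp s * weight l' b' ν) :
    ∑ ν ∈ B, weight l b ν ≤ Real.exp (s + logZOff U l' b') := by
  calc ∑ ν ∈ B, weight l b ν ≤ ∑ ν ∈ B, Real.exp s * weight l' b' ν := Finset.sum_le_sum h
    _ = Real.exp s * ∑ ν ∈ B, weight l' b' ν := by rw [Finset.mul_sum]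
    _ ≤ Real.exp s * ∑ ν ∈ boxChains T M, weight l' b' ν := by
        gcongr
        exact fun ν _ _ => weight_nonneg hl' b' ν
    _ ≤ Real.exp s * Real.exp (logZOff U l' b') := by
        gcongr
        exact sum_weight_le hl' hb' hTU M
    _ = _ := by rw [Real.exp_add]

lemma weight_eq_exp_mul_weight_inverse_temp (l b b' : ℝ) (ν : Xc →₀ ℕ) :
    weight l b ν = Real.exp ((b' - b) * totalLength ν) * weight l b' ν := by
  unfold weight
  rw [mul_left_comm, ← Real.exp_add]
  ring_nf

lemma weight_eq_exp_mul_weight_fugacity (l b η : ℝ) (ν : Xc →₀ ℕ) :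
    weight l b ν = Real.exp (-(η * ν.support.card)) * weight (l * Real.exp η) b ν := by
  unfold weight
  rw [mul_pow, ← Real.exp_nat_mul, ← mul_assoc, mul_left_comm (Real.exp (-(η * _))),
    ← Real.exp_add, mul_comm η]
  simp

/-- Concentration: if the tilted partition functions are small enough, then a finite set of chains
with controlled length and number of vertices carries a fixed proportion of the Gibbs mass. -/
lemma exists_concentrated {l b η δ ℓm ℓp km kp : ℝ} (hl : 0 < l) (hb : 0 < b) (hη : 0 < η)
    (hη1 : η < 1) (hδ : 0 < δ) (U : Finset Xc)
    (h1 : -(η * b * ℓp) + logZOff U l ((1 - η) * b) ≤ logZOff U l b - 4)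
    (h2 : -(η * kp) + logZOff U (l * Real.exp η) b ≤ logZOff U l b - 4)
    (h3 : η * km + logZOff U (l * Real.exp (-η)) b ≤ logZOff U l b - 4)
    (h4 : δ * b * ℓm + logZOff U l ((1 + δ) * b) ≤ logZOff U l b - 4) :
    ∃ (T : Finset Xc) (M : ℕ) (G : Finset (Xc →₀ ℕ)), Disjoint T U ∧ G ⊆ boxChains T M ∧
      (∀ ν ∈ G, ℓm ≤ totalLength ν ∧ totalLength ν ≤ ℓp ∧ km ≤ ν.support.card ∧
        (ν.support.card : ℝ) ≤ kp) ∧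
      Real.exp (logZOff U l b - 2) ≤ ∑ ν ∈ G, weight l b ν := by
  classical
  obtain ⟨T, M, hTU, hZ⟩ := exists_le_sum_weight hl hb U
  set H := boxChains T M with hH
  set G := H.filter fun ν => ℓm ≤ totalLength ν ∧ totalLength ν ≤ ℓp ∧ km ≤ ν.support.card ∧
        (ν.support.card : ℝ) ≤ kp with hG
  refine ⟨T, M, G, hTU, Finset.filter_subset _ _, fun ν hν => (Finset.mem_filter.1 hν).2, ?_⟩
  set B1 := H.filter fun ν => ℓp < totalLength ν with hB1
  set B2 := H.filter fun ν => kp < (ν.support.card : ℝ) with hB2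
  set B3 := H.filter fun ν => (ν.support.card : ℝ) < km with hB3
  set B4 := H.filter fun ν => totalLength ν < ℓm with hB4
  have hw := weight_nonneg hl b
  have hsub : H ⊆ G ∪ (B1 ∪ (B2 ∪ (B3 ∪ B4))) := by
    intro ν hν
    simp only [hG, hB1, hB2, hB3, hB4, Finset.mem_union, Finset.mem_filter, hν, true_and]
    by_contra hc
    push Not at hc
    exact absurd (hc.1 hc.2.2.2.2 hc.2.1 hc.2.2.2.1) (not_lt.2 hc.2.2.1)
  have hun : ∀ A B : Finset (Xc →₀ ℕ), ∑ ν ∈ A ∪ B, weight l b ν ≤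
      ∑ ν ∈ A, weight l b ν + ∑ ν ∈ B, weight l b ν := by
    intro A B
    rw [← Finset.sum_union_inter]
    exact le_add_of_nonneg_right (Finset.sum_nonneg fun ν _ => hw ν)
  have htot : ∑ ν ∈ H, weight l b ν ≤ ∑ ν ∈ G, weight l b ν + (∑ ν ∈ B1, weight l b ν +
      (∑ ν ∈ B2, weight l b ν + (∑ ν ∈ B3, weight l b ν + ∑ ν ∈ B4, weight l b ν))) := by
    refine (Finset.sum_le_sum_of_subset_of_nonneg hsub fun ν _ _ => hw ν).trans ?_
    have e1 := hun G (B1 ∪ (B2 ∪ (B3 ∪ B4)))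
    have e2 := hun B1 (B2 ∪ (B3 ∪ B4))
    have e3 := hun B2 (B3 ∪ B4)
    have e4 := hun B3 B4
    linarith
  have b1 : ∑ ν ∈ B1, weight l b ν ≤ Real.exp (logZOff U l b - 4) := by
    refine (sum_weight_le_of_tilt (s := -(η * b * ℓp)) hl (mul_pos (sub_pos.2 hη1) hb) hTU
      (Finset.filter_subset _ _) fun ν hν => ?_).trans (Real.exp_le_exp.2 h1)
    rw [weight_eq_exp_mul_weight_inverse_temp l b ((1 - η) * b)]
    refine mul_le_mul_of_nonneg_right (Real.exp_le_exp.2 ?_) (weight_nonneg hl _ _)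
    have := (Finset.mem_filter.1 hν).2
    nlinarith [mul_le_mul_of_nonneg_left this.le (mul_pos hη hb).le]
  have b2 : ∑ ν ∈ B2, weight l b ν ≤ Real.exp (logZOff U l b - 4) := by
    refine (sum_weight_le_of_tilt (s := -(η * kp)) (l' := l * Real.exp η) (by positivity) hb hTU
      (Finset.filter_subset _ _) fun ν hν => ?_).trans (Real.exp_le_exp.2 h2)
    rw [weight_eq_exp_mul_weight_fugacity l b η]
    refine mul_le_mul_of_nonneg_right (Real.exp_le_exp.2 ?_) (weight_nonneg (by positivity) _ _)
    have := (Finset.mem_filter.1 hν).2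
    nlinarith [mul_le_mul_of_nonneg_left this.le hη.le]
  have b3 : ∑ ν ∈ B3, weight l b ν ≤ Real.exp (logZOff U l b - 4) := by
    refine (sum_weight_le_of_tilt (s := η * km) (l' := l * Real.exp (-η)) (by positivity) hb hTU
      (Finset.filter_subset _ _) fun ν hν => ?_).trans (Real.exp_le_exp.2 h3)
    rw [weight_eq_exp_mul_weight_fugacity l b (-η)]
    refine mul_le_mul_of_nonneg_right (Real.exp_le_exp.2 ?_) (weight_nonneg (by positivity) _ _)
    have := (Finset.mem_filter.1 hν).2
    nlinarith [mul_le_mul_of_nonneg_left this.le hη.le]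
  have b4 : ∑ ν ∈ B4, weight l b ν ≤ Real.exp (logZOff U l b - 4) := by
    refine (sum_weight_le_of_tilt (s := δ * b * ℓm) hl
      (mul_pos (by linarith : 0 < 1 + δ) hb) hTU
      (Finset.filter_subset _ _) fun ν hν => ?_).trans (Real.exp_le_exp.2 h4)
    rw [weight_eq_exp_mul_weight_inverse_temp l b ((1 + δ) * b)]
    refine mul_le_mul_of_nonneg_right (Real.exp_le_exp.2 ?_) (weight_nonneg hl _ _)
    have := (Finset.mem_filter.1 hν).2
    nlinarith [mul_le_mul_of_nonneg_left this.le (mul_pos hδ hb).le]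
  have e1 : Real.exp (logZOff U l b - 1) = Real.exp (logZOff U l b - 4) * Real.exp 1 ^ 3 := by
    rw [← Real.exp_nat_mul, ← Real.exp_add]; push_cast; ring_nf
  have e2 : Real.exp (logZOff U l b - 2) = Real.exp (logZOff U l b - 4) * Real.exp 1 ^ 2 := by
    rw [← Real.exp_nat_mul, ← Real.exp_add]; push_cast; ring_nf
  have e3 : (2 : ℝ) < Real.exp 1 := by have := Real.exp_one_gt_d9; linarith
  have e4 : Real.exp 1 ^ 2 + 4 ≤ Real.exp 1 ^ 3 := by nlinarith [sq_nonneg (Real.exp 1 - 2)]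
  have := mul_le_mul_of_nonneg_left e4 (Real.exp_pos (logZOff U l b - 4)).le
  linarith

/-- Quantitative lower bound for the number of chains. -/
lemma le_log_numChainsLen {l b η δ ℓm ℓp km kp : ℝ} (hl : 0 < l) (hb : 0 < b) (hη : 0 < η)
    (hη1 : η < 1) (hδ : 0 < δ) {Q : Finset Xc} (hQ : unitVec ∉ Q) {n N : ℕ}
    (h1 : -(η * b * ℓp) + logZOff (insert unitVec Q) l ((1 - η) * b) ≤
      logZOff (insert unitVec Q) l b - 4)
    (h2 : -(η * kp) + logZOff (insert unitVec Q) (l * Real.exp η) b ≤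
      logZOff (insert unitVec Q) l b - 4)
    (h3 : η * km + logZOff (insert unitVec Q) (l * Real.exp (-η)) b ≤
      logZOff (insert unitVec Q) l b - 4)
    (h4 : δ * b * ℓm + logZOff (insert unitVec Q) l ((1 + δ) * b) ≤
      logZOff (insert unitVec Q) l b - 4)
    (hℓ : ℓp + ∑ x ∈ Q, xnorm x + 1 ≤ n) (hkp : kp + 1 ≤ N) (hkm : N ≤ km + Q.card) :
    0 < numChainsLen n N ∧ logZOff (insert unitVec Q) l b - 2 + b * ℓm - N * Real.log l -
      Q.card * |Real.log l| ≤ Real.log (numChainsLen n N) := by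
  obtain ⟨T, M, G, hTU, hG, hc, hsum⟩ :=
    exists_concentrated hl hb hη hη1 hδ (insert unitVec Q) h1 h2 h3 h4
  have hle : G.card ≤ numChainsLen n N := by
    refine card_le_numChainsLen hQ hTU hG (fun ν hν => (hc ν hν).2.1) (fun ν hν => ?_)
      (fun ν hν => ?_) hℓ
    · have := (hc ν hν).2.2.2
      have : (ν.support.card : ℝ) + 1 ≤ N := by linarith
      exact_mod_cast this
    · have := (hc ν hν).2.2.1
      have : (N : ℝ) ≤ ν.support.card + 1 + Q.card := by linarith
      exact_mod_cast this
  have hwle : ∀ ν ∈ G, weight l b ν ≤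
      Real.exp (N * Real.log l + Q.card * |Real.log l| - b * ℓm) := by
    intro ν hν
    obtain ⟨c1, c2, c3, c4⟩ := hc ν hν
    have : weight l b ν = Real.exp (ν.support.card * Real.log l - b * totalLength ν) := by
      unfold weight
      rw [sub_eq_add_neg, Real.exp_add, Real.exp_nat_mul, Real.exp_log hl]
    rw [this]
    refine Real.exp_le_exp.2 ?_
    have hbl := mul_le_mul_of_nonneg_left c1 hb.le
    have h5 : ((ν.support.card : ℝ) - N) * Real.log l ≤ Q.card * |Real.log l| := by
      refine (le_abs_self _).trans ?_
      rw [abs_mul]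
      gcongr
      rw [abs_le]
      constructor <;> linarith
    linarith
  have hsum2 := hsum.trans (Finset.sum_le_card_nsmul _ _ _ hwle)
  rw [nsmul_eq_mul] at hsum2
  have hGpos : (0 : ℝ) < G.card := by
    by_contra hcon
    have h0 : (G.card : ℝ) = 0 := le_antisymm (not_lt.1 hcon) (Nat.cast_nonneg _)
    rw [h0, zero_mul] at hsum2
    exact absurd hsum2 (not_le.2 (Real.exp_pos _))
  have hpos : 0 < numChainsLen n N := lt_of_lt_of_le (by exact_mod_cast hGpos) hle
  refine ⟨hpos, ?_⟩
  have h5 := Real.log_le_log (Real.exp_pos _) hsum2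
  rw [Real.log_exp, Real.log_mul hGpos.ne' (Real.exp_pos _).ne', Real.log_exp] at h5
  have h6 := Real.log_le_log hGpos (by exact_mod_cast hle : (G.card : ℝ) ≤ numChainsLen n N)
  linarith

/-- Quantitative upper bound for the number of chains. -/
lemma log_numChainsLen_le {l b : ℝ} (hl : 0 < l) (hb : 0 < b) {n N : ℕ}
    (hpos : 0 < numChainsLen n N) :
    Real.log (numChainsLen n N) ≤ b * (n + 1) - N * Real.log l + logZ l b := by
  classical
  set H := boxChains (finite_xnorm_lt ((n + 1 : ℕ) : ℝ)).toFinset (n + 1)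
  set G := H.filter fun ν => totalLength ν ∈ Set.Ico (n : ℝ) ((n : ℝ) + 1) ∧ ν.support.card = N
    with hG
  have hcard : numChainsLen n N = G.card := by
    rw [numChainsLen, ← Nat.card_eq_finsetCard]
    refine Nat.card_congr (Equiv.subtypeEquivRight fun ν => ?_)
    rw [hG, Finset.mem_filter]
    refine ⟨fun h => ⟨mem_boxChains_of_totalLength_lt ?_, h⟩, fun h => h.2⟩
    push_cast
    exact h.1.2
  have h1 : ∑ ν ∈ H, weight l b ν ≤ Real.exp (logZ l b) := by
    have := sum_weight_le hl hb (T := (finite_xnorm_lt ((n + 1 : ℕ) : ℝ)).toFinset) (U := ∅)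
      (Finset.disjoint_empty_right _) (n + 1)
    rw [logZOff, Finset.sum_empty, sub_zero] at this
    exact this
  have h2 : ∀ ν ∈ G, Real.exp (N * Real.log l - b * (n + 1)) ≤ weight l b ν := by
    intro ν hν
    obtain ⟨h, hN⟩ := (Finset.mem_filter.1 hν).2
    unfold weight
    rw [sub_eq_add_neg, Real.exp_add, Real.exp_nat_mul, Real.exp_log hl, hN]
    gcongr
    exact h.2.le
  have h3 := Finset.card_nsmul_le_sum _ _ _ h2
  have h4 : ∑ ν ∈ G, weight l b ν ≤ ∑ ν ∈ H, weight l b ν :=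
    Finset.sum_le_sum_of_subset_of_nonneg (Finset.filter_subset _ _)
      fun ν _ _ => weight_nonneg hl b ν
  rw [nsmul_eq_mul, ← hcard] at h3
  have hpos' : (0 : ℝ) < numChainsLen n N := by exact_mod_cast hpos
  have h5 := Real.log_le_log (by positivity) (h3.trans (h4.trans h1))
  rw [Real.log_mul hpos'.ne' (Real.exp_pos _).ne', Real.log_exp, Real.log_exp] at h5
  linarith

/-- Limit of the rescaled logarithm of the partition function. -/
noncomputable def freeEnergy (l : ℝ) : ℝ := π / 2 * Aint l / zeta2

/-- Limit of the rescaled mean number of vertices. -/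
noncomputable def occupation (l : ℝ) : ℝ := π / 2 * Bint l / zeta2

lemma zeta2_pos : 0 < zeta2 := by unfold zeta2; positivity

lemma freeEnergy_pos {l : ℝ} (hl : 0 < l) : 0 < freeEnergy l := by
  have := Aint_pos hl
  have := zeta2_pos
  unfold freeEnergy; positivity

lemma occupation_pos {l : ℝ} (hl : 0 < l) : 0 < occupation l := by
  have := Bint_pos hl
  have := zeta2_pos
  unfold occupation; positivity

lemma freeEnergy_mul_exp_le {l : ℝ} (hl : 0 < l) (η : ℝ) :
    freeEnergy (l * Real.exp η) ≤ freeEnergy l + (Real.exp η - 1) * occupation l := by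
  have hz := zeta2_pos
  have h : freeEnergy l + (Real.exp η - 1) * occupation l =
      π / 2 * (Aint l + (Real.exp η - 1) * Bint l) / zeta2 := by
    unfold freeEnergy occupation; ring
  rw [h, freeEnergy]
  have := Aint_mul_exp_le hl η
  gcongr

lemma tendsto_const_mul_nhdsGT {v : ℝ} (hv : 0 < v) :
    Tendsto (fun b : ℝ => v * b) (nhdsWithin 0 (Set.Ioi 0)) (nhdsWithin 0 (Set.Ioi 0)) := by
  refine tendsto_nhdsWithin_iff.2 ⟨?_, ?_⟩
  · have : Tendsto (fun b : ℝ => v * b) (nhds 0) (nhds (v * 0)) :=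
      (continuous_const.mul continuous_id).tendsto 0
    rw [mul_zero] at this
    exact this.mono_left nhdsWithin_le_nhds
  · filter_upwards [self_mem_nhdsWithin] with b hb
    exact mul_pos hv hb

lemma tendsto_sq_mul_logZ_mul {l v : ℝ} (hl : 0 < l) (hv : 0 < v) :
    Tendsto (fun b : ℝ => b ^ 2 * logZ l (v * b)) (nhdsWithin 0 (Set.Ioi 0))
      (nhds (freeEnergy l / v ^ 2)) := by
  have h := ((tendsto_sq_mul_logZ hl).comp (tendsto_const_mul_nhdsGT hv)).div_const (v ^ 2)
  refine h.congr fun b => ?_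
  simp only [Function.comp]
  field_simp

lemma tendsto_pow_nhdsGT {k : ℕ} (hk : k ≠ 0) :
    Tendsto (fun b : ℝ => b ^ k) (nhdsWithin 0 (Set.Ioi 0)) (nhds 0) := by
  have : Tendsto (fun b : ℝ => b ^ k) (nhds 0) (nhds (0 ^ k)) := (continuous_pow k).tendsto 0
  rw [zero_pow hk] at this
  exact this.mono_left nhdsWithin_le_nhds

lemma tendsto_const_div_nhdsGT {c : ℝ} (hc : 0 < c) :
    Tendsto (fun b : ℝ => c / b) (nhdsWithin 0 (Set.Ioi 0)) atTop := by
  simp only [div_eq_mul_inv]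
  exact tendsto_inv_nhdsGT_zero.const_mul_atTop hc

lemma tendsto_sq_mul_siteF {l v : ℝ} (hl : 0 < l) (hv : 0 < v) :
    Tendsto (fun b : ℝ => b ^ 2 * siteF l (v * b)) (nhdsWithin 0 (Set.Ioi 0)) (nhds 0) := by
  have h : Tendsto (fun b : ℝ => l / v * b ^ 1) (nhdsWithin 0 (Set.Ioi 0)) (nhds (l / v * 0)) :=
    (tendsto_pow_nhdsGT one_ne_zero).const_mul _
  rw [mul_zero] at h
  refine tendsto_of_tendsto_of_tendsto_of_le_of_le' tendsto_const_nhds h ?_ ?_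
  · filter_upwards [self_mem_nhdsWithin] with b hb
    exact mul_nonneg (sq_nonneg b) (siteF_nonneg hl (mul_pos hv hb))
  · filter_upwards [self_mem_nhdsWithin] with b hb
    have hb : 0 < b := hb
    have := mul_le_mul_of_nonneg_left (siteF_le_div hl (mul_pos hv hb)) (sq_nonneg b)
    refine this.trans (le_of_eq ?_)
    field_simp

lemma tendsto_sq_mul_ceil {ρ : ℝ} (hρ : 0 < ρ) :
    Tendsto (fun b : ℝ => b ^ 2 * (⌈ρ / b ^ 2⌉₊ : ℝ)) (nhdsWithin 0 (Set.Ioi 0)) (nhds ρ) := by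
  have h : Tendsto (fun b : ℝ => ρ + b ^ 2) (nhdsWithin 0 (Set.Ioi 0)) (nhds (ρ + 0)) :=
    (tendsto_pow_nhdsGT two_ne_zero).const_add _
  rw [add_zero] at h
  refine tendsto_of_tendsto_of_tendsto_of_le_of_le' tendsto_const_nhds h ?_ ?_
  · filter_upwards [self_mem_nhdsWithin] with b hb
    have hb : 0 < b := hb
    have := mul_le_mul_of_nonneg_left (Nat.le_ceil (ρ / b ^ 2)) (sq_nonneg b)
    rwa [mul_div_cancel₀ _ (by positivity)] at this
  · filter_upwards [self_mem_nhdsWithin] with b hb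
    have hb : 0 < b := hb
    have := mul_le_mul_of_nonneg_left
      (Nat.ceil_lt_add_one (show 0 ≤ ρ / b ^ 2 by positivity)).le (sq_nonneg b)
    rwa [mul_add, mul_div_cancel₀ _ (by positivity), mul_one] at this

lemma tendsto_sq_mul_floor {D : ℝ} (hD : 0 < D) :
    Tendsto (fun b : ℝ => b ^ 2 * (⌊D / b ^ 2⌋₊ : ℝ)) (nhdsWithin 0 (Set.Ioi 0)) (nhds D) := by
  have h : Tendsto (fun b : ℝ => D - b ^ 2) (nhdsWithin 0 (Set.Ioi 0)) (nhds (D - 0)) :=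
    (tendsto_pow_nhdsGT two_ne_zero).const_sub _
  rw [sub_zero] at h
  refine tendsto_of_tendsto_of_tendsto_of_le_of_le' h tendsto_const_nhds ?_ ?_
  · filter_upwards [self_mem_nhdsWithin] with b hb
    have hb : 0 < b := hb
    have := mul_le_mul_of_nonneg_left (Nat.sub_one_lt_floor (D / b ^ 2)).le (sq_nonneg b)
    rwa [mul_sub, mul_div_cancel₀ _ (by positivity), mul_one] at this
  · filter_upwards [self_mem_nhdsWithin] with b hb
    have hb : 0 < b := hb
    have := mul_le_mul_of_nonneg_left
      (Nat.floor_le (show 0 ≤ D / b ^ 2 by positivity)) (sq_nonneg b)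
    rwa [mul_div_cancel₀ _ (by positivity)] at this

lemma eventually_le_neg_of_tendsto {f : ℝ → ℝ} {L : ℝ} (hL : L < 0) (K : ℝ)
    (h : Tendsto (fun b : ℝ => b ^ 2 * f b) (nhdsWithin 0 (Set.Ioi 0)) (nhds L)) :
    ∀ᶠ b in nhdsWithin (0 : ℝ) (Set.Ioi 0), f b ≤ -K := by
  have h1 : Tendsto (fun b : ℝ => b ^ 2 * f b + b ^ 2 * K) (nhdsWithin 0 (Set.Ioi 0))
      (nhds (L + 0 * K)) := h.add ((tendsto_pow_nhdsGT two_ne_zero).mul_const K)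
  have hL' : L + 0 * K < 0 := by linarith
  filter_upwards [h1.eventually_lt_const hL', self_mem_nhdsWithin] with b hb hb0
  have hb0 : 0 < b := hb0
  rw [← mul_add] at hb
  have := neg_of_mul_neg_right hb (sq_nonneg b)
  linarith

lemma primCount_eq_card_toFinset (R : ℝ) : primCount R = (finite_xnorm_lt R).toFinset.card := by
  rw [← Nat.card_eq_card_finite_toFinset (finite_xnorm_lt R)]
  rfl

lemma tendsto_sq_mul_primCount {c : ℝ} (hc : 0 < c) :
    Tendsto (fun b : ℝ => b ^ 2 * (primCount (c / b) : ℝ)) (nhdsWithin 0 (Set.Ioi 0))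
      (nhds (c ^ 2 * (π / (4 * zeta2)))) := by
  have h := (tendsto_primCount_div_sq.comp (tendsto_const_div_nhdsGT hc)).const_mul (c ^ 2)
  refine h.congr' ?_
  filter_upwards [self_mem_nhdsWithin] with b hb
  have hb : 0 < b := hb
  simp only [Function.comp]
  field_simp

/-- Existence of a reserved set of primitive vectors in an annulus. -/
lemma eventually_exists_reserved {c ρ : ℝ} (hc : 0 < c)
    (h : ρ < 3 / 4 * c ^ 2 * (π / (4 * zeta2))) :
    ∀ᶠ b in nhdsWithin (0 : ℝ) (Set.Ioi 0), ∃ Q : Finset Xc, unitVec ∉ Q ∧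
      Q.card = ⌈ρ / b ^ 2⌉₊ ∧ ∀ x ∈ Q, c / 2 ≤ b * xnorm x ∧ b * xnorm x ≤ c := by
  classical
  have hlim := (tendsto_sq_mul_primCount hc).sub (tendsto_sq_mul_primCount (half_pos hc))
  have hlt : ρ < c ^ 2 * (π / (4 * zeta2)) - (c / 2) ^ 2 * (π / (4 * zeta2)) := by
    refine h.trans_eq ?_
    ring
  have hsm : ∀ᶠ b in nhdsWithin (0 : ℝ) (Set.Ioi 0), b < c / 2 :=
    nhdsWithin_le_nhds (gt_mem_nhds (half_pos hc))
  filter_upwards [hlim.eventually_const_lt hlt, hsm, self_mem_nhdsWithin] with b hb hbc hb0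
  have hb0 : 0 < b := hb0
  set A := (finite_xnorm_lt (c / b)).toFinset
  set B := (finite_xnorm_lt (c / 2 / b)).toFinset
  have hBA : B ⊆ A := by
    intro x hx
    simp only [A, B, Set.Finite.mem_toFinset, Set.mem_ofPred_eq] at hx ⊢
    refine hx.trans_le ?_
    gcongr
    linarith
  have hcard : ((A \ B).card : ℝ) = primCount (c / b) - primCount (c / 2 / b) := by
    rw [primCount_eq_card_toFinset, primCount_eq_card_toFinset,
      Finset.cast_card_sdiff hBA]
  have hle : ⌈ρ / b ^ 2⌉₊ ≤ (A \ B).card := by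
    rw [Nat.ceil_le, div_le_iff₀ (by positivity), hcard]
    linarith
  obtain ⟨Q, hQ, hQc⟩ := Finset.exists_subset_card_eq hle
  have hmem : ∀ x ∈ Q, c / 2 ≤ b * xnorm x ∧ b * xnorm x ≤ c := by
    intro x hx
    have := hQ hx
    simp only [A, B, Finset.mem_sdiff, Set.Finite.mem_toFinset, Set.mem_ofPred_eq, not_lt] at this
    rw [lt_div_iff₀ hb0, div_le_iff₀ hb0] at this
    constructor <;> linarith
  refine ⟨Q, fun hu => ?_, hQc, hmem⟩
  have := (hmem _ hu).1
  rw [xnorm_unitVec] at this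
  linarith

set_option maxHeartbeats 1000000 in
/-- Lower bound for the number of chains, for parameters satisfying the limiting forms of the
Chernoff conditions. -/
lemma eventually_le_sq_mul_log_numChainsLen {l w η δ ρ c ε ε' : ℝ} (hl : 0 < l) (hw : 0 < w)
    (hw1 : w ≤ 1) (hη : 0 < η) (hη1 : η < 1) (hδ : 0 < δ) (hρ : 0 < ρ) (hc : 0 < c)
    (hc4 : c ≤ 1 / 4) (hcl : Real.exp c - 1 ≤ l / 3)
    (hρc : ρ < 3 / 4 * c ^ 2 * (π / (4 * zeta2))) (hε' : 0 < ε')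
    (hA : freeEnergy l / ((1 - η) * w) ^ 2 - freeEnergy l / w ^ 2 - ρ * (3 / 4 * η - η ^ 2) -
      η * w * (2 * freeEnergy l - ρ / 3) < 0)
    (hB : freeEnergy (l * Real.exp η) / w ^ 2 - freeEnergy l / w ^ 2 - ρ * (3 / 4 * η - η ^ 2) -
      η * (occupation l - ρ / 2) < 0)
    (hC : freeEnergy (l * Real.exp (-η)) / w ^ 2 - freeEnergy l / w ^ 2 + η * occupation l < 0)
    (hD : freeEnergy l / ((1 + δ) * w) ^ 2 - freeEnergy l / w ^ 2 + ρ * siteF l (w * c / 2) +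
      δ * w * (2 * freeEnergy l - ε) < 0) :
    ∀ᶠ b in nhdsWithin (0 : ℝ) (Set.Ioi 0), ∀ n : ℕ, (n : ℝ) = 2 * freeEnergy l / b ^ 3 →
      0 < numChainsLen n ⌊occupation l / b ^ 2⌋₊ ∧
      freeEnergy l / w ^ 2 - ρ * siteF l (w * c / 2) + w * (2 * freeEnergy l - ε) -
        occupation l * Real.log l - ρ * |Real.log l| - ε' ≤
        b ^ 2 * Real.log (numChainsLen n ⌊occupation l / b ^ 2⌋₊) := by
  have hη' : 0 < 1 - η := sub_pos.2 hη1
  have hδ' : 0 < 1 + δ := by linarith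
  have hlp : 0 < l * Real.exp η := by positivity
  have hlm : 0 < l * Real.exp (-η) := by positivity
  have hocc := occupation_pos hl
  set Φ := freeEnergy l with hΦ
  set D := occupation l with hDdef
  set f := siteF l (w * c / 2) with hf
  have tZ : ∀ {l' v : ℝ}, 0 < l' → 0 < v → Tendsto (fun b : ℝ => b ^ 2 * logZ l' (v * b))
      (nhdsWithin 0 (Set.Ioi 0)) (nhds (freeEnergy l' / v ^ 2)) := tendsto_sq_mul_logZ_mul
  have tq := tendsto_sq_mul_ceil hρ
  have tcst : ∀ K : ℝ, Tendsto (fun b : ℝ => b ^ 2 * K) (nhdsWithin 0 (Set.Ioi 0)) (nhds 0) := by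
    intro K
    simpa using (tendsto_pow_nhdsGT two_ne_zero).mul_const K
  have eA : ∀ᶠ b in nhdsWithin (0 : ℝ) (Set.Ioi 0), logZ l ((1 - η) * w * b) - logZ l (w * b) -
      ⌈ρ / b ^ 2⌉₊ * (3 / 4 * η - η ^ 2) - η * (w * b) * ((2 * Φ - ρ / 3) / b ^ 3) ≤ -4 := by
    refine eventually_le_neg_of_tendsto hA 4 ?_
    have h := (((tZ hl (mul_pos hη' hw)).sub (tZ hl hw)).sub
      (tq.mul_const (3 / 4 * η - η ^ 2))).sub_const (η * w * (2 * Φ - ρ / 3))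
    refine h.congr' ?_
    filter_upwards [self_mem_nhdsWithin] with b hb
    have hb : 0 < b := hb
    field_simp
  have eB : ∀ᶠ b in nhdsWithin (0 : ℝ) (Set.Ioi 0), logZ (l * Real.exp η) (w * b) -
      logZ l (w * b) - ⌈ρ / b ^ 2⌉₊ * (3 / 4 * η - η ^ 2) - η * ((D - ρ / 2) / b ^ 2) ≤ -4 := by
    refine eventually_le_neg_of_tendsto hB 4 ?_
    have h := (((tZ hlp hw).sub (tZ hl hw)).sub
      (tq.mul_const (3 / 4 * η - η ^ 2))).sub_const (η * (D - ρ / 2))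
    refine h.congr' ?_
    filter_upwards [self_mem_nhdsWithin] with b hb
    have hb : 0 < b := hb
    field_simp
  have eC : ∀ᶠ b in nhdsWithin (0 : ℝ) (Set.Ioi 0), logZ (l * Real.exp (-η)) (w * b) -
      logZ l (w * b) + η * (D / b ^ 2) + η ≤ -4 := by
    refine eventually_le_neg_of_tendsto hC 4 ?_
    have h := (((tZ hlm hw).sub (tZ hl hw)).add_const (η * D)).add (tcst η)
    rw [add_zero] at h
    refine h.congr' ?_
    filter_upwards [self_mem_nhdsWithin] with b hb
    have hb : 0 < b := hb
    field_simp
  have eD : ∀ᶠ b in nhdsWithin (0 : ℝ) (Set.Ioi 0), logZ l ((1 + δ) * w * b) -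
      logZ l (w * b) + ⌈ρ / b ^ 2⌉₊ * f + siteF l (w * b) +
      δ * (w * b) * ((2 * Φ - ε) / b ^ 3) ≤ -4 := by
    refine eventually_le_neg_of_tendsto hD 4 ?_
    have h := ((((tZ hl (mul_pos hδ' hw)).sub (tZ hl hw)).add
      (tq.mul_const f)).add (tendsto_sq_mul_siteF hl hw)).add_const (δ * w * (2 * Φ - ε))
    rw [add_zero] at h
    refine h.congr' ?_
    filter_upwards [self_mem_nhdsWithin] with b hb
    have hb : 0 < b := hb
    field_simp
  have eE : ∀ᶠ b in nhdsWithin (0 : ℝ) (Set.Ioi 0),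
      Φ / w ^ 2 - ρ * f + w * (2 * Φ - ε) - D * Real.log l - ρ * |Real.log l| - ε' <
      b ^ 2 * (logZ l (w * b) - ⌈ρ / b ^ 2⌉₊ * f - siteF l (w * b) - 2 +
        w * b * ((2 * Φ - ε) / b ^ 3) - ⌊D / b ^ 2⌋₊ * Real.log l -
        ⌈ρ / b ^ 2⌉₊ * |Real.log l|) := by
    have h := (((((((tZ hl hw).sub (tq.mul_const f)).sub (tendsto_sq_mul_siteF hl hw)).sub
      (tcst 2)).add_const (w * (2 * Φ - ε))).sub
      ((tendsto_sq_mul_floor hocc).mul_const (Real.log l))).sub (tq.mul_const |Real.log l|))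
    rw [sub_zero, sub_zero] at h
    have h' := h.eventually_const_lt (sub_lt_self _ hε')
    filter_upwards [h', self_mem_nhdsWithin] with b hb1 hb
    have hb : 0 < b := hb
    refine hb1.trans_eq ?_
    field_simp
  have eL : ∀ᶠ b in nhdsWithin (0 : ℝ) (Set.Ioi 0),
      b ^ 2 * (⌈ρ / b ^ 2⌉₊ : ℝ) * (1 / 4) + b ^ 3 < ρ / 3 := by
    have h := (tq.mul_const (1 / 4)).add (tendsto_pow_nhdsGT three_ne_zero)
    exact h.eventually_lt_const (by linarith)
  have eN : ∀ᶠ b in nhdsWithin (0 : ℝ) (Set.Ioi 0), b ^ 2 * 2 < ρ / 2 :=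
    (tcst 2).eventually_lt_const (by linarith)
  filter_upwards [eA, eB, eC, eD, eE, eL, eN, eventually_exists_reserved hc hρc,
    self_mem_nhdsWithin] with b hA hB hC hD hE hL hN hQ hb n hn
  have hb : 0 < b := hb
  have hwb : 0 < w * b := mul_pos hw hb
  obtain ⟨Q, hQu, hQc, hQx⟩ := hQ
  rw [← hQc] at hA hB hD hE hL
  set U := insert unitVec Q with hU
  have hoff : ∀ l' b', logZOff U l' b' = logZ l' b' - siteF l' b' -
      ∑ x ∈ Q, siteF l' (b' * xnorm x) := by
    intro l' b'
    rw [logZOff, hU, Finset.sum_insert hQu, xnorm_unitVec, mul_one]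
    ring
  have hr : ∀ x ∈ Q, w * c / 2 ≤ w * b * xnorm x ∧ w * b * xnorm x ≤ c := by
    intro x hx
    obtain ⟨h1, h2⟩ := hQx x hx
    have h3 := mul_le_mul_of_nonneg_left h1 hw.le
    have h4 := mul_le_of_le_one_left ((mul_pos hb (xnorm_pos x)).le) hw1
    exact ⟨by linarith only [h3], by linarith only [h2, h4]⟩
  have hrpos : ∀ x : Xc, 0 < w * b * xnorm x := fun x => mul_pos hwb (xnorm_pos x)
  have hgain : ∀ x ∈ Q, 3 / 4 * η - η ^ 2 ≤ η * siteP l (w * b * xnorm x) - η ^ 2 := by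
    intro x hx
    have h1 := exp_sub_one_pos (hrpos x)
    have h2 := Real.exp_le_exp.2 (hr x hx).2
    have h3 : 3 / 4 ≤ siteP l (w * b * xnorm x) := by
      rw [siteP_eq hl (hrpos x), le_div_iff₀ (by positivity)]
      linarith only [h2, hcl]
    linarith only [mul_le_mul_of_nonneg_left h3 hη.le]
  have hFle : ∑ x ∈ Q, siteF l (w * b * xnorm x) ≤ Q.card * f := by
    rw [← nsmul_eq_mul]
    exact Finset.sum_le_card_nsmul _ _ _ fun x hx =>
      siteF_anti hl (by positivity) (hr x hx).1
  have hsub : ∀ {l' b' K : ℝ}, (∀ x ∈ Q, siteF l (w * b * xnorm x) + K ≤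
      siteF l' (b' * xnorm x)) → ∑ x ∈ Q, siteF l (w * b * xnorm x) + Q.card * K ≤
      ∑ x ∈ Q, siteF l' (b' * xnorm x) := by
    intro l' b' K h
    rw [← nsmul_eq_mul, ← Finset.sum_const, ← Finset.sum_add_distrib]
    exact Finset.sum_le_sum h
  have key := le_log_numChainsLen (n := n) (N := ⌊D / b ^ 2⌋₊) (ℓm := (2 * Φ - ε) / b ^ 3)
    (ℓp := (2 * Φ - ρ / 3) / b ^ 3) (km := D / b ^ 2 - Q.card) (kp := (D - ρ / 2) / b ^ 2)
    hl hwb hη hη1 hδ hQu ?_ ?_ ?_ ?_ ?_ ?_ ?_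
  · refine ⟨key.1, hE.le.trans (mul_le_mul_of_nonneg_left (le_trans ?_ key.2) (sq_nonneg b))⟩
    rw [hoff]
    linarith only [hFle]
  · rw [hoff, hoff, ← mul_assoc (1 - η) w b]
    have h1 := hsub (l' := l) (b' := (1 - η) * w * b) (K := 3 / 4 * η - η ^ 2) fun x hx => by
      have := siteF_add_le_siteF_one_sub_mul hl (hrpos x) hη.le hη1
      have h2 := hgain x hx
      rw [show (1 - η) * w * b * xnorm x = (1 - η) * (w * b * xnorm x) by ring]
      linarith only [this, h2]
    have h2 : siteF l (w * b) ≤ siteF l ((1 - η) * w * b) :=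
      siteF_anti hl (by positivity) (by rw [mul_assoc]; linarith only [mul_pos hη hwb])
    linarith only [h1, h2, hA]
  · rw [hoff, hoff]
    have h1 := hsub (l' := l * Real.exp η) (b' := w * b) (K := 3 / 4 * η - η ^ 2) fun x hx => by
      have := siteF_add_le_siteF_mul_exp hl (hrpos x) hη.le
      have h2 := hgain x hx
      linarith only [this, h2]
    have h2 : siteF l (w * b) ≤ siteF (l * Real.exp η) (w * b) := by
      have h3 := exp_sub_one_pos hwb
      have h4 := Real.one_le_exp hη.le
      unfold siteF
      gcongr
      exact le_mul_of_one_le_right hl.le h4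
    linarith only [h1, h2, hB]
  · rw [hoff, hoff]
    have h1 := hsub (l' := l * Real.exp (-η)) (b' := w * b) (K := -η) fun x hx => by
      have := siteF_le_add_siteF_mul_exp_neg hl (hrpos x) hη.le
      linarith only [this]
    have h2 := siteF_le_add_siteF_mul_exp_neg hl hwb hη.le
    linarith only [h1, h2, hC]
  · rw [hoff, hoff, ← mul_assoc (1 + δ) w b]
    have hb' : 0 < (1 + δ) * w * b := by positivity
    have h1 : 0 ≤ ∑ x ∈ Q, siteF l ((1 + δ) * w * b * xnorm x) :=
      Finset.sum_nonneg fun x _ => siteF_xnorm_nonneg hl hb' x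
    have h2 := siteF_nonneg hl hb'
    linarith only [h1, h2, hD, hFle]
  · have h1 : ∑ x ∈ Q, xnorm x ≤ Q.card * (1 / 4 / b) := by
      rw [← nsmul_eq_mul]
      refine Finset.sum_le_card_nsmul _ _ _ fun x hx => ?_
      rw [le_div_iff₀ hb]
      have := (hQx x hx).2
      linarith only [this, hc4]
    rw [hn]
    have h2 : (2 * Φ - ρ / 3) / b ^ 3 + Q.card * (1 / 4 / b) + 1 =
        (2 * Φ - ρ / 3 + (b ^ 2 * Q.card * (1 / 4) + b ^ 3)) / b ^ 3 := by
      field_simp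
      ring
    refine le_trans (by linarith only [h1]) (h2.le.trans ?_)
    gcongr
    linarith only [hL]
  · have h1 := Nat.sub_one_lt_floor (D / b ^ 2)
    have h2 : (D - ρ / 2) / b ^ 2 + 2 ≤ D / b ^ 2 := by
      have : (D - ρ / 2) / b ^ 2 + 2 = (D - ρ / 2 + b ^ 2 * 2) / b ^ 2 := by field_simp
      rw [this]
      gcongr
      linarith only [hN]
    linarith only [h1, h2]
  · have h1 := Nat.floor_le (show 0 ≤ D / b ^ 2 by positivity)
    linarith only [h1]

lemma eventually_nhdsGT_lt_of_continuous {g : ℝ → ℝ} (hg : Continuous g) {K : ℝ} (h : g 0 < K) :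
    ∀ᶠ x in nhdsWithin (0 : ℝ) (Set.Ioi 0), g x < K :=
  nhdsWithin_le_nhds ((hg.tendsto 0).eventually_lt_const h)

lemma inv_one_add_sq_le {δ : ℝ} (hδ : 0 < δ) : 1 / (1 + δ) ^ 2 ≤ 1 - 2 * δ + 3 * δ ^ 2 := by
  rw [div_le_iff₀ (by positivity)]
  nlinarith [pow_pos hδ 3, pow_pos hδ 4]

lemma inv_one_sub_sq_le {η : ℝ} (hη : 0 < η) (hη1 : η < 1 / 4) :
    1 / (1 - η) ^ 2 ≤ 1 + 2 * η + 8 * η ^ 2 := by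
  have h : 0 < 1 - η := by linarith
  rw [div_le_iff₀ (by positivity)]
  have h2 := mul_pos (pow_pos hη 2) (show 0 < 5 - 14 * η + 8 * η ^ 2 by nlinarith)
  nlinarith

set_option maxHeartbeats 1000000 in
/-- Lower bound for the number of chains. -/
lemma eventually_lower_bound {l ε₀ : ℝ} (hl : 0 < l) (hε₀ : 0 < ε₀) :
    ∀ᶠ b in nhdsWithin (0 : ℝ) (Set.Ioi 0), ∀ n : ℕ, (n : ℝ) = 2 * freeEnergy l / b ^ 3 →
      0 < numChainsLen n ⌊occupation l / b ^ 2⌋₊ ∧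
      3 * freeEnergy l - occupation l * Real.log l - ε₀ ≤
        b ^ 2 * Real.log (numChainsLen n ⌊occupation l / b ^ 2⌋₊) := by
  have hΦ := freeEnergy_pos hl
  have hD := occupation_pos hl
  have hlp := freeEnergy_mul_exp_le hl
  have hz := zeta2_pos
  set Φ := freeEnergy l
  set D := occupation l
  set c : ℝ := min (1 / 4) (Real.log (1 + l / 3)) with hc
  have hc0 : 0 < c := lt_min (by norm_num) (Real.log_pos (by linarith))
  have hc4 : c ≤ 1 / 4 := min_le_left _ _
  have hcl : Real.exp c - 1 ≤ l / 3 := by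
    have h := Real.exp_le_exp.2 (min_le_right (1 / 4) (Real.log (1 + l / 3)))
    rw [Real.exp_log (by positivity)] at h
    linarith
  set F := siteF l (c / 4) with hF
  have hF0 : 0 ≤ F := siteF_nonneg hl (by positivity)
  set ε : ℝ := min (ε₀ / 5) Φ with hε
  have hε0 : 0 < ε := lt_min (by positivity) hΦ
  have hε1 : ε ≤ ε₀ / 5 := min_le_left _ _
  have hε2 : ε ≤ Φ := min_le_right _ _
  set δ : ℝ := ε / (6 * Φ) with hδ
  have hδ0 : 0 < δ := by positivity
  have hδΦ : δ * Φ = ε / 6 := by rw [hδ]; field_simp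
  obtain ⟨ρ, ⟨⟨⟨hρ1, hρ2⟩, hρ3⟩, hρ4⟩, hρ0⟩ :=
    ((((eventually_nhdsGT_lt_of_continuous (g := fun ρ => ρ) (by fun_prop)
      (show (0 : ℝ) < 3 / 4 * c ^ 2 * (π / (4 * zeta2)) by positivity)).and
    (eventually_nhdsGT_lt_of_continuous (g := fun ρ => ρ * F) (by fun_prop)
      (show 0 * F < ε₀ / 5 by linarith))).and
    (eventually_nhdsGT_lt_of_continuous (g := fun ρ => ρ * F) (by fun_prop)
      (show 0 * F < δ * ε / 2 by rw [zero_mul]; positivity))).and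
    (eventually_nhdsGT_lt_of_continuous (g := fun ρ => ρ * |Real.log l|) (by fun_prop)
      (show 0 * |Real.log l| < ε₀ / 5 by linarith))).and self_mem_nhdsWithin |>.exists
  have hρ0 : 0 < ρ := hρ0
  have hcont : ∀ {g : ℝ → ℝ} {K : ℝ}, ContinuousAt g 1 → g 1 < K →
      ∀ᶠ w in nhdsWithin (1 : ℝ) (Set.Iio 1), g w < K := fun hg h =>
    nhdsWithin_le_nhds (hg.eventually_lt_const h)
  obtain ⟨w, ⟨⟨⟨hw1, hw2⟩, hw3⟩, hw4⟩, hw5⟩ :=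
    ((((hcont (g := fun w => 1 - w) (K := 1 / 2) (by fun_prop) (by norm_num)).and
    (hcont (g := fun w => 2 * Φ * (1 - w)) (K := ε₀ / 5) (by fun_prop) (by linarith))).and
    (hcont (g := fun w => Φ / w ^ 2 * 2 - ρ * (3 / 4) - w * (2 * Φ - ρ / 3)) (K := 0)
      (by fun_prop (disch := norm_num)) (by linarith))).and
    (hcont (g := fun w => D / w ^ 2 - ρ * (3 / 4) - (D - ρ / 2)) (K := 0)
      (by fun_prop (disch := norm_num)) (by linarith))).and self_mem_nhdsWithin |>.exists
  have hw5 : w < 1 := hw5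
  have hw0 : 1 / 2 < w := by linarith
  have hwpos : 0 < w := by linarith
  have hw6 : 1 < 1 / w ^ 2 := by
    rw [lt_div_iff₀ (by positivity)]
    nlinarith
  have hDw : D < D / w ^ 2 := by
    rw [← mul_one_div]
    exact lt_mul_of_one_lt_right hD hw6
  have hΦw : Φ < Φ / w ^ 2 := by
    rw [← mul_one_div]
    exact lt_mul_of_one_lt_right hΦ hw6
  obtain ⟨η, ⟨⟨⟨hη1, hη2⟩, hη3⟩, hη4⟩, hη0⟩ :=
    ((((eventually_nhdsGT_lt_of_continuous (g := fun η => η) (by fun_prop)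
      (show (0 : ℝ) < 1 / 4 by norm_num)).and
    (eventually_nhdsGT_lt_of_continuous (K := 0)
      (g := fun η => Φ / w ^ 2 * (2 + 8 * η) - ρ * (3 / 4 - η) - w * (2 * Φ - ρ / 3))
      (by fun_prop) (by simpa using hw3))).and
    (eventually_nhdsGT_lt_of_continuous (K := 0)
      (g := fun η => D / w ^ 2 * (1 + η) - ρ * (3 / 4 - η) - (D - ρ / 2))
      (by fun_prop) (by simpa using hw4))).and
    (eventually_nhdsGT_lt_of_continuous (K := 0)
      (g := fun η => D / w ^ 2 * (-1 + η) + D)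
      (by fun_prop) (by simp only [add_zero]; linarith))).and self_mem_nhdsWithin |>.exists
  have hη0 : 0 < η := hη0
  have hexp1 : Real.exp η - 1 ≤ η + η ^ 2 := by
    have := (abs_le.1 (Real.abs_exp_sub_one_sub_id_le (x := η)
      (by rw [abs_of_pos hη0]; linarith))).2
    linarith
  have hexp2 : Real.exp (-η) - 1 ≤ -η + η ^ 2 := by
    have := (abs_le.1 (Real.abs_exp_sub_one_sub_id_le (x := -η)
      (by rw [abs_neg, abs_of_pos hη0]; linarith))).2
    linarith
  have hf : siteF l (w * c / 2) ≤ F := siteF_anti hl (by positivity)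
    (by linarith only [mul_lt_mul_of_pos_right hw0 hc0])
  have hρf : ρ * siteF l (w * c / 2) ≤ ρ * F := mul_le_mul_of_nonneg_left hf hρ0.le
  have htilt : ∀ ζ K : ℝ, Real.exp ζ - 1 ≤ K →
      freeEnergy (l * Real.exp ζ) / w ^ 2 - Φ / w ^ 2 ≤ D / w ^ 2 * K := by
    intro ζ K h
    have h1 := hlp ζ
    have h2 : freeEnergy (l * Real.exp ζ) ≤ Φ + D * K := by
      linarith only [h1, mul_le_mul_of_nonneg_right h hD.le]
    have h3 : (Φ + D * K) / w ^ 2 = Φ / w ^ 2 + D / w ^ 2 * K := by ring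
    have h4 := div_le_div_of_nonneg_right h2 (sq_nonneg w)
    linarith only [h2, h3, h4]
  have main := eventually_le_sq_mul_log_numChainsLen (ε := ε) (ε' := ε₀ / 5) hl hwpos hw5.le hη0
    (by linarith) hδ0 hρ0 hc0 hc4 hcl hρ1 (by positivity) ?_ ?_ ?_ ?_
  · filter_upwards [main] with b hb n hn
    obtain ⟨h1, h2⟩ := hb n hn
    refine ⟨h1, le_trans ?_ h2⟩
    have h3 : 2 * Φ * w - ε ≤ w * (2 * Φ - ε) := by
      linarith only [mul_nonneg hε0.le (sub_nonneg.2 hw5.le)]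
    linarith only [h3, hρf, hρ2, hρ4, hw2, hε1, hΦw]
  · have h1 : Φ / ((1 - η) * w) ^ 2 = Φ / w ^ 2 * (1 / (1 - η) ^ 2) := by
      rw [mul_pow]; field_simp
    have h2 := mul_le_mul_of_nonneg_left (inv_one_sub_sq_le hη0 hη1) (hΦ.trans hΦw).le
    rw [h1]
    have h3 := mul_neg_of_pos_of_neg hη0 hη2
    linarith only [h2, h3]
  · have h1 := htilt η _ hexp1
    have h3 := mul_neg_of_pos_of_neg hη0 hη3
    linarith only [h1, h3]
  · have h1 := htilt (-η) _ hexp2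
    have h3 := mul_neg_of_pos_of_neg hη0 hη4
    linarith only [h1, h3]
  · have h1 : Φ / ((1 + δ) * w) ^ 2 = Φ / w ^ 2 * (1 / (1 + δ) ^ 2) := by
      rw [mul_pow]; field_simp
    have h2 := inv_one_add_sq_le hδ0
    have hδ1 : δ ≤ 1 / 6 := by rw [hδ, div_le_iff₀ (by positivity)]; linarith
    have h3 : Φ / w ^ 2 * (1 / (1 + δ) ^ 2) - Φ / w ^ 2 ≤ Φ * (-2 * δ + 3 * δ ^ 2) := by
      have h4 := mul_le_mul_of_nonneg_left h2 (hΦ.trans hΦw).le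
      have h5 : -2 * δ + 3 * δ ^ 2 ≤ 0 := by
        linarith only [hδ0, mul_le_mul_of_nonneg_left hδ1 hδ0.le]
      linarith only [h4, mul_le_mul_of_nonpos_right hΦw.le h5]
    have h6 : δ * w * (2 * Φ - ε) ≤ δ * (2 * Φ - ε) := by
      have : 0 ≤ δ * (2 * Φ - ε) * (1 - w) :=
        mul_nonneg (mul_nonneg hδ0.le (by linarith only [hε2, hΦ])) (by linarith only [hw5])
      linarith only [this]
    have h7 : 3 * Φ * δ ^ 2 = δ * ε / 2 := by
      linear_combination 3 * δ * hδΦ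
    rw [h1]
    linarith only [h3, h6, h7, hρf, hρ3]

/-- Upper bound for the number of chains. -/
lemma eventually_upper_bound {l ε : ℝ} (hl : 0 < l) (hε : 0 < ε) :
    ∀ᶠ b in nhdsWithin (0 : ℝ) (Set.Ioi 0), ∀ n : ℕ, (n : ℝ) = 2 * freeEnergy l / b ^ 3 →
      0 < numChainsLen n ⌊occupation l / b ^ 2⌋₊ →
      b ^ 2 * Real.log (numChainsLen n ⌊occupation l / b ^ 2⌋₊) ≤
        3 * freeEnergy l - occupation l * Real.log l + ε := by
  have h := (((tendsto_pow_nhdsGT three_ne_zero).const_add (2 * freeEnergy l)).sub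
    ((tendsto_sq_mul_floor (occupation_pos hl)).mul_const (Real.log l))).add
    (tendsto_sq_mul_logZ_mul hl one_pos)
  have hlt : 2 * freeEnergy l + 0 - occupation l * Real.log l + freeEnergy l / 1 ^ 2 <
      3 * freeEnergy l - occupation l * Real.log l + ε := by linarith
  filter_upwards [h.eventually_lt_const hlt, self_mem_nhdsWithin] with b h1 hb n hn hpos
  have hb : 0 < b := hb
  have h2 := mul_le_mul_of_nonneg_left (log_numChainsLen_le hl hb hpos) (sq_nonneg b)
  refine h2.trans (le_trans (le_of_eq ?_) h1.le)
  rw [hn]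
  field_simp

lemma two_mul_freeEnergy_rpow {l : ℝ} (hl : 0 < l) :
    (2 * freeEnergy l) ^ ((2:ℝ)/3) =
      (π ^ ((1:ℝ)/3) * Aint l ^ ((1:ℝ)/3) / zeta2 ^ ((1:ℝ)/3)) ^ 2 := by
  have hA := Aint_pos hl
  have hz := zeta2_pos
  have h : 2 * freeEnergy l = π * Aint l / zeta2 := by unfold freeEnergy; ring
  rw [h, ← Real.mul_rpow Real.pi_pos.le hA.le, ← Real.div_rpow (by positivity) hz.le,
    ← Real.rpow_mul_natCast (by positivity)]
  norm_num

lemma rpow_third_pow_three {x : ℝ} (hx : 0 < x) : (x ^ ((1:ℝ)/3)) ^ 3 = x := by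
  rw [← Real.rpow_mul_natCast hx.le]
  norm_num

lemma rpow_two_thirds {x : ℝ} (hx : 0 < x) : x ^ ((2:ℝ)/3) = (x ^ ((1:ℝ)/3)) ^ 2 := by
  rw [← Real.rpow_mul_natCast hx.le]
  norm_num

lemma cfun_mul {l : ℝ} (hl : 0 < l) :
    π ^ ((1:ℝ)/3) / 2 * cfun l * (2 * freeEnergy l) ^ ((2:ℝ)/3) = occupation l := by
  have hA := Aint_pos hl
  have hz := zeta2_pos
  have h1 := rpow_third_pow_three Real.pi_pos
  have h2 := rpow_third_pow_three hz
  have ha : 0 < Aint l ^ ((1:ℝ)/3) := by positivity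
  have hz' : 0 < zeta2 ^ ((1:ℝ)/3) := by positivity
  rw [two_mul_freeEnergy_rpow hl, cfun, rpow_two_thirds hA, occupation]
  conv_rhs => rw [← h1, ← h2]
  field_simp

lemma efun_mul {l : ℝ} (hl : 0 < l) :
    π ^ ((1:ℝ)/3) / 2 * efun l * (2 * freeEnergy l) ^ ((2:ℝ)/3) =
      3 * freeEnergy l - occupation l * Real.log l := by
  have hA := Aint_pos hl
  have hz := zeta2_pos
  have h0 := rpow_third_pow_three hA
  have h1 := rpow_third_pow_three Real.pi_pos
  have h2 := rpow_third_pow_three hz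
  have ha : 0 < Aint l ^ ((1:ℝ)/3) := by positivity
  have hz' : 0 < zeta2 ^ ((1:ℝ)/3) := by positivity
  have h3 : π ^ ((1:ℝ)/3) / 2 * (3 * (Aint l / zeta2) ^ ((1:ℝ)/3)) *
      (2 * freeEnergy l) ^ ((2:ℝ)/3) = 3 * freeEnergy l := by
    rw [two_mul_freeEnergy_rpow hl, Real.div_rpow hA.le hz.le, freeEnergy]
    conv_rhs => rw [← h1, ← h2, ← h0]
    field_simp
  rw [← cfun_mul hl, ← h3, efun]
  ring

/-- For every `λ > 0`,
`ln 𝒩̃(n, ⌊(π^{1/3}/2)·c(λ)·n^{2/3}⌋) = n^{2/3}·((π^{1/3}/2)·e(λ) + o(1))` as `n → ∞`. -/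
theorem statement10 (l : ℝ) (hl : 0 < l) :
    (fun n : ℕ =>
        Real.log (numChainsLen n ⌊π ^ ((1:ℝ)/3) / 2 * cfun l * (n : ℝ) ^ ((2:ℝ)/3)⌋₊)
          - (n : ℝ) ^ ((2:ℝ)/3) * (π ^ ((1:ℝ)/3) / 2 * efun l))
      =o[atTop] (fun n : ℕ => (n : ℝ) ^ ((2:ℝ)/3)) := by
  have hΦ := freeEnergy_pos hl
  set K : ℝ := (2 * freeEnergy l) ^ ((2:ℝ)/3) with hK
  have hK0 : 0 < K := by positivity
  have hlim : Tendsto (fun n : ℕ => (2 * freeEnergy l / (n : ℝ)) ^ ((1:ℝ)/3)) atTop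
      (nhdsWithin 0 (Set.Ioi 0)) := by
    refine tendsto_nhdsWithin_iff.2 ⟨?_, ?_⟩
    · have h1 : Tendsto (fun n : ℕ => 2 * freeEnergy l / (n : ℝ)) atTop (nhds 0) :=
        tendsto_const_nhds.div_atTop tendsto_natCast_atTop_atTop
      have h2 := h1.rpow_const (p := (1:ℝ)/3) (Or.inr (by norm_num))
      rwa [Real.zero_rpow (by norm_num)] at h2
    · filter_upwards [eventually_gt_atTop 0] with n hn
      have hn : (0 : ℝ) < n := by exact_mod_cast hn
      exact Set.mem_Ioi.2 (by positivity)
  rw [isLittleO_iff]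
  intro C hC
  filter_upwards [hlim.eventually (eventually_lower_bound hl (mul_pos hC hK0)),
    hlim.eventually (eventually_upper_bound hl (mul_pos hC hK0)), eventually_gt_atTop 0]
    with n h1 h2 hn
  have hn : (0 : ℝ) < n := by exact_mod_cast hn
  set b := (2 * freeEnergy l / (n : ℝ)) ^ ((1:ℝ)/3) with hb
  have hb0 : 0 < b := by positivity
  have hb3 : b ^ 3 = 2 * freeEnergy l / n := rpow_third_pow_three (by positivity)
  have hnb : (n : ℝ) = 2 * freeEnergy l / b ^ 3 := by rw [hb3]; field_simp
  have hb2 : (n : ℝ) ^ ((2:ℝ)/3) = K / b ^ 2 := by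
    rw [hb, ← rpow_two_thirds (by positivity), Real.div_rpow (by positivity) hn.le, ← hK]
    field_simp
  have hN : π ^ ((1:ℝ)/3) / 2 * cfun l * (n : ℝ) ^ ((2:ℝ)/3) = occupation l / b ^ 2 := by
    rw [hb2, ← mul_div_assoc, cfun_mul hl]
  have hE : (n : ℝ) ^ ((2:ℝ)/3) * (π ^ ((1:ℝ)/3) / 2 * efun l) =
      (3 * freeEnergy l - occupation l * Real.log l) / b ^ 2 := by
    rw [hb2, ← efun_mul hl]
    ring
  obtain ⟨hpos, hlow⟩ := h1 n hnb
  have hup := h2 n hnb hpos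
  rw [hN, hE, hb2, Real.norm_eq_abs, Real.norm_eq_abs, abs_of_pos (by positivity : 0 < K / b ^ 2)]
  set L := Real.log (numChainsLen n ⌊occupation l / b ^ 2⌋₊)
  have e : L - (3 * freeEnergy l - occupation l * Real.log l) / b ^ 2 =
      (b ^ 2 * L - (3 * freeEnergy l - occupation l * Real.log l)) / b ^ 2 := by field_simp
  rw [e, abs_div, abs_of_pos (by positivity : 0 < b ^ 2), ← mul_div_assoc]
  gcongr
  rw [abs_le]
  constructor <;> linarith
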